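/- Let K ⊂ ℂ be a number field of degree d with ring of integers O_K, let 1 ≤ D ≤ S be integers, let 𝓕 be a finite set of homogeneous polynomials of degree S in O_K[X_0,…,X_t] with no common zero in ℙ^t(ℂ) (i.e., no common nonzero zero in ℂ^{t+1}), let P be a nonzero homogeneous polynomial of degree D in K[X_0,…,X_t], and let (ξ_1,…,ξ_t) ∈ ℂ^t. Suppose B and δ are positive real numbers such that ‖Q^σ‖ ≤ B and |Q(1,ξ_1,…,ξ_t)| ≤ δ for every Q ∈ 𝓕 and every embedding σ of K into ℂ. Then 1 ≤ H(P)^{dS^t} · ( (t+1)^{8S} S^{2t} B )^{dtDS^{t−1}} · max{ δ/B, |P(1,ξ_1,…,ξ_t)|/‖P‖ }. -/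

import Mathlib

open scoped BigOperators

/-- `H_∞(u) = (∏_σ max_i |σ (u i)|)^{1/d}`, the product over the `d`
embeddings `σ : K → ℂ` of the number field `K`. -/
noncomputable def HinfV (K : IntermediateField ℚ ℂ) [NumberField K]
    {ι : Type*} [Fintype ι] (u : ι → K) : ℝ :=
  (∏ σ : K →+* ℂ, ⨆ i, ‖σ (u i)‖) ^ ((Module.finrank ℚ K : ℝ))⁻¹

/-- `H_fin(u) = N_{K/ℚ}(𝔞)^{-1/d}`, where `𝔞` is the fractional ideal of `K`
generated by the coordinates of `u`. -/
noncomputable def HfinV (K : IntermediateField ℚ ℂ) [NumberField K]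
    {ι : Type*} [Fintype ι] (u : ι → K) : ℝ :=
  ((FractionalIdeal.absNorm (FractionalIdeal.spanFinset (NumberField.RingOfIntegers K)
      (Finset.univ : Finset ι) u) : ℚ) : ℝ) ^ (-(Module.finrank ℚ K : ℝ)⁻¹)

/-- The absolute Weil height `H(u) = H_∞(u) · H_fin(u)`. -/
noncomputable def HV (K : IntermediateField ℚ ℂ) [NumberField K]
    {ι : Type*} [Fintype ι] (u : ι → K) : ℝ := HinfV K u * HfinV K u

/-- The height `H(P)` of a nonzero polynomial with coefficients in `K`:
the height of its vector of coefficients. -/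
noncomputable def polyH (K : IntermediateField ℚ ℂ) [NumberField K] {t : ℕ}
    (Q : MvPolynomial (Fin (t + 1)) K) : ℝ :=
  HV K (fun m : ↥Q.support => Q.coeff m)

/-- `‖Q‖`: the maximum of the absolute values of the coefficients of `Q`. -/
noncomputable def polyNorm (K : IntermediateField ℚ ℂ) {t : ℕ}
    (Q : MvPolynomial (Fin (t + 1)) K) : ℝ :=
  ⨆ m : ↥Q.support, ‖((Q.coeff m : K) : ℂ)‖


namespace BM
open MvPolynomial

def Mon (t n : ℕ) : Type := {m : Fin (t+1) →₀ ℕ // m.degree = n}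

noncomputable instance (t n : ℕ) : Fintype (Mon t n) :=
  Fintype.subtype (Finset.finsuppAntidiag (Finset.univ : Finset (Fin (t+1))) n) (by
    intro m
    rw [Finset.mem_finsuppAntidiag, Finsupp.degree_eq_sum]
    simp)

noncomputable instance (t n : ℕ) : DecidableEq (Mon t n) := Classical.decEq _

section
variable {A : Type*} [CommRing A] {t : ℕ}

noncomputable def mpow (x : Fin (t+1) → A) (m : Fin (t+1) →₀ ℕ) : A := ∏ j, x j ^ m j

noncomputable def ev {n : ℕ} (c : Mon t n → A) (x : Fin (t+1) → A) : A :=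
  ∑ m, c m * mpow x m.1

noncomputable def pf {n : ℕ} (c : Mon t n → A) : MvPolynomial (Fin (t+1)) A :=
  ∑ m, monomial m.1 (c m)

noncomputable def pw (j : Fin (t+1)) (n : ℕ) : Mon t n := ⟨Finsupp.single j n, by simp⟩

lemma eval_pf {n : ℕ} (c : Mon t n → A) (x : Fin (t+1) → A) :
    eval x (pf c) = ev c x := by
  simp only [pf, ev, map_sum, eval_monomial, mpow]
  refine Finset.sum_congr rfl fun m _ => ?_
  rw [Finsupp.prod_fintype _ _ (by simp)]

lemma pf_hom {n : ℕ} (c : Mon t n → A) : (pf c).IsHomogeneous n := by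
  unfold pf
  apply MvPolynomial.IsHomogeneous.sum
  intro m _
  exact isHomogeneous_monomial _ m.2

lemma coeff_pf {n : ℕ} (c : Mon t n → A) (m : Mon t n) : coeff m.1 (pf c) = c m := by
  classical
  simp only [pf, coeff_sum, coeff_monomial]
  rw [Finset.sum_eq_single m]
  · simp
  · intro b _ hb
    rw [if_neg]
    intro h
    exact hb (Subtype.ext h)
  · simp

lemma pf_coeff {n : ℕ} (p : MvPolynomial (Fin (t+1)) A) (hp : p.IsHomogeneous n) :
    pf (fun m : Mon t n => coeff m.1 p) = p := by
  ext m
  by_cases hm : m.degree = n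
  · exact coeff_pf (fun m : Mon t n => coeff m.1 p) ⟨m, hm⟩
  · rw [(pf_hom _).coeff_eq_zero hm, hp.coeff_eq_zero hm]

lemma map_pf {B : Type*} [CommRing B] (φ : A →+* B) {n : ℕ} (c : Mon t n → A) :
    map φ (pf c) = pf (fun m => φ (c m)) := by
  simp [pf]

lemma sum_coeff_mpow {n : ℕ} (p : MvPolynomial (Fin (t+1)) A) (hp : p.IsHomogeneous n)
    (x : Fin (t+1) → A) : ∑ m : Mon t n, coeff m.1 p * mpow x m.1 = eval x p := by
  conv_rhs => rw [← pf_coeff p hp]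
  rw [eval_pf]; rfl

lemma ev_single {n : ℕ} (j : Fin (t+1)) (a : A) (x : Fin (t+1) → A) :
    ev (Pi.single (pw j n) a) x = a * x j ^ n := by
  unfold ev
  rw [Finset.sum_eq_single (pw j n)]
  · rw [Pi.single_eq_same]
    simp only [mpow, pw]
    rw [Finset.prod_eq_single j]
    · simp
    · intro b _ hb
      simp [Finsupp.single_apply, Ne.symm hb]
    · simp
  · intro b _ hb
    simp [Pi.single_eq_of_ne hb]
  · simp

lemma pf_single {n : ℕ} (j : Fin (t+1)) (a : A) :
    pf (Pi.single (pw j n) a) = monomial (Finsupp.single j n) a := by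
  unfold pf
  rw [Finset.sum_eq_single (pw j n)]
  · rw [Pi.single_eq_same]; rfl
  · intro b _ hb
    simp [Pi.single_eq_of_ne hb]
  · simp

lemma ev_add {n : ℕ} (c c' : Mon t n → A) (x : Fin (t+1) → A) :
    ev (c + c') x = ev c x + ev c' x := by
  simp [ev, add_mul, Finset.sum_add_distrib]

lemma ev_sub {n : ℕ} (c c' : Mon t n → A) (x : Fin (t+1) → A) :
    ev (c - c') x = ev c x - ev c' x := by
  simp [ev, sub_mul, Finset.sum_sub_distrib]

lemma ev_smul {n : ℕ} (a : A) (c : Mon t n → A) (x : Fin (t+1) → A) :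
    ev (a • c) x = a * ev c x := by
  simp [ev, Finset.mul_sum, mul_assoc]

lemma mpow_smul {n : ℕ} (a : A) (x : Fin (t+1) → A) (m : Mon t n) :
    mpow (a • x) m.1 = a ^ n * mpow x m.1 := by
  have := m.2
  rw [Finsupp.degree_eq_sum] at this
  simp only [mpow, Pi.smul_apply, smul_eq_mul, mul_pow, Finset.prod_mul_distrib]
  rw [Finset.prod_pow_eq_pow_sum, this]

lemma ev_smul_right {n : ℕ} (a : A) (c : Mon t n → A) (x : Fin (t+1) → A) :
    ev c (a • x) = a ^ n * ev c x := by
  simp only [ev, Finset.mul_sum, mpow_smul]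
  refine Finset.sum_congr rfl fun m _ => by ring

lemma map_mpow {B : Type*} [CommRing B] (φ : A →+* B) (x : Fin (t+1) → A) (m) :
    φ (mpow x m) = mpow (fun j => φ (x j)) m := by
  simp [mpow]

lemma map_ev {B : Type*} [CommRing B] (φ : A →+* B) {n : ℕ} (c : Mon t n → A)
    (x : Fin (t+1) → A) :
    φ (ev c x) = ev (fun m => φ (c m)) (fun j => φ (x j)) := by
  simp [ev, map_mpow]

/-- universal index set -/
abbrev U (t : ℕ) (d : Fin (t+1) → ℕ) : Type := Σ i : Fin (t+1), Mon t (d i)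

variable {d : Fin (t+1) → ℕ}

noncomputable def macE (c : ∀ i, Mon t (d i) → A) (i : Fin (t+1)) (s m' : Fin (t+1) →₀ ℕ) : A :=
  coeff m' (monomial s 1 * pf (c i))

lemma map_macE {B : Type*} [CommRing B] (φ : A →+* B) (c : ∀ i, Mon t (d i) → A) (i s m') :
    φ (macE c i s m') = macE (fun i m => φ (c i m)) i s m' := by
  simp only [macE]
  rw [← coeff_map]
  simp [map_pf]

noncomputable def gen (t : ℕ) (d : Fin (t+1) → ℕ) :
    ∀ i, Mon t (d i) → MvPolynomial (U t d) ℤ := fun i m => X ⟨i, m⟩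

noncomputable def mac {n : ℕ} (c : ∀ i, Mon t (d i) → A) (ι : Mon t n → Fin (t+1))
    (s : Mon t n → (Fin (t+1) →₀ ℕ)) : Matrix (Mon t n) (Mon t n) A :=
  Matrix.of fun m m' => macE c (ι m) (s m) m'.1

lemma map_mac_det {B : Type*} [CommRing B] (φ : A →+* B) {n : ℕ} (c : ∀ i, Mon t (d i) → A)
    (ι : Mon t n → Fin (t+1)) (s : Mon t n → (Fin (t+1) →₀ ℕ)) :
    φ (mac c ι s).det = (mac (fun i m => φ (c i m)) ι s).det := by
  rw [RingHom.map_det]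
  congr 1
  ext m m'
  simp [mac, map_macE]

lemma mac_det_zero [IsDomain A] {n : ℕ} (c : ∀ i, Mon t (d i) → A)
    (ι : Mon t n → Fin (t+1)) (s : Mon t n → (Fin (t+1) →₀ ℕ))
    (hs : ∀ m, (s m).degree + d (ι m) = n) (x : Fin (t+1) → A) (hx : x 0 = 1)
    (hc : ∀ i, ev (c i) x = 0) : (mac c ι s).det = 0 := by
  rw [← Matrix.exists_mulVec_eq_zero_iff]
  refine ⟨fun m => mpow x m.1, ?_, ?_⟩
  · intro h
    have := congrFun h (pw 0 n)
    have h2 : mpow x (pw (t := t) 0 n).1 = 1 := by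
      have := ev_single (n := n) (0 : Fin (t+1)) 1 x
      simp only [mpow, pw]
      apply Finset.prod_eq_one
      intro j _
      by_cases hj : j = 0
      · simp [hj, hx]
      · simp [Finsupp.single_apply, Ne.symm hj]
    simp [h2] at this
  · ext m
    simp only [Matrix.mulVec, dotProduct, mac, Matrix.of_apply, macE, Pi.zero_apply]
    rw [sum_coeff_mpow]
    · rw [map_mul, eval_pf, hc, mul_zero]
    · have := (isHomogeneous_monomial (1 : A) (d := s m) rfl).mul (pf_hom (c (ι m)))
      rwa [hs] at this

end

noncomputable def gx (t : ℕ) (d : Fin (t+1) → ℕ) : Fin (t+1) → MvPolynomial (U t d ⊕ Fin t) ℤ :=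
  Fin.cons 1 (fun j => X (Sum.inr j))

noncomputable def gF (t : ℕ) (d : Fin (t+1) → ℕ) (i : Fin (t+1)) :
    MvPolynomial (U t d ⊕ Fin t) ℤ :=
  ev (fun m : Mon t (d i) => X (Sum.inl ⟨i, m⟩)) (gx t d)

noncomputable def thv (t : ℕ) (d : Fin (t+1) → ℕ) (u : U t d) : MvPolynomial (U t d ⊕ Fin t) ℤ :=
  X (Sum.inl u) - if u = ⟨u.1, pw 0 (d u.1)⟩ then gF t d u.1 else 0

noncomputable def th (t : ℕ) (d : Fin (t+1) → ℕ) :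
    MvPolynomial (U t d) ℤ →ₐ[ℤ] MvPolynomial (U t d ⊕ Fin t) ℤ := aeval (thv t d)

lemma th_ev (t : ℕ) (d : Fin (t+1) → ℕ) (i : Fin (t+1)) :
    ev (fun m => th t d (gen t d i m)) (gx t d) = 0 := by
  have : (fun m => th t d (gen t d i m)) =
    (fun m : Mon t (d i) => X (Sum.inl ⟨i, m⟩)) - Pi.single (pw 0 (d i)) (gF t d i) := by
    ext1 m
    simp only [th, gen, aeval_X, thv, Pi.sub_apply]
    congr 1
    by_cases h : m = pw 0 (d i)
    · subst h
      simp
    · rw [if_neg, Pi.single_eq_of_ne h]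
      intro h'
      apply h
      simpa using h'
  rw [this, ev_sub, ev_single]
  simp [gF, gx]

lemma mac_mem {t : ℕ} {d : Fin (t+1) → ℕ} {n : ℕ}
    (ι : Mon t n → Fin (t+1)) (s : Mon t n → (Fin (t+1) →₀ ℕ))
    (hs : ∀ m, (s m).degree + d (ι m) = n) :
    th t d (mac (gen t d) ι s).det = 0 := by
  have := map_mac_det (th t d).toRingHom (gen t d) ι s
  simp only [AlgHom.toRingHom_eq_coe, RingHom.coe_coe] at this
  rw [this]
  exact mac_det_zero _ ι s hs (gx t d) (by simp [gx]) (fun i => th_ev t d i)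

/-- weights -/
noncomputable def wt {t : ℕ} (d : Fin (t+1) → ℕ) (i : Fin (t+1)) : U t d → ℕ :=
  fun u => if u.1 = i then 1 else 0

lemma macE_gen_hom {t : ℕ} {d : Fin (t+1) → ℕ} (i k : Fin (t+1)) (s m') :
    IsWeightedHomogeneous (wt d i) (macE (gen t d) k s m') (if k = i then 1 else 0) := by
  classical
  unfold macE
  rw [coeff_monomial_mul']
  split_ifs with h1 h2 h2
  all_goals try exact isWeightedHomogeneous_zero _ _ _
  all_goals
    rw [one_mul]
    by_cases hm : (m' - s).degree = d k
    · have := coeff_pf (gen t d k) ⟨m' - s, hm⟩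
      simp only at this
      rw [this]
      have := isWeightedHomogeneous_X ℤ (wt d i) (⟨k, ⟨m' - s, hm⟩⟩ : U t d)
      simpa [wt, h2, gen] using this
    · rw [(pf_hom _).coeff_eq_zero hm]
      exact isWeightedHomogeneous_zero _ _ _

lemma mac_hom {t : ℕ} {d : Fin (t+1) → ℕ} {n : ℕ} (i : Fin (t+1))
    (ι : Mon t n → Fin (t+1)) (s : Mon t n → (Fin (t+1) →₀ ℕ)) :
    IsWeightedHomogeneous (wt d i) (mac (gen t d) ι s).det
      (Finset.univ.filter (fun m => ι m = i)).card := by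
  classical
  rw [Matrix.det_apply]
  apply IsWeightedHomogeneous.sum
  intro π _
  have h : IsWeightedHomogeneous (wt d i) (∏ m, mac (gen t d) ι s (π m) m)
      (∑ m, if ι (π m) = i then 1 else 0) := by
    apply IsWeightedHomogeneous.prod
    intro m _
    exact macE_gen_hom i _ _ _
  have h2 : (∑ m, if ι (π m) = i then 1 else 0) = (Finset.univ.filter (fun m => ι m = i)).card := by
    rw [Equiv.sum_comp π (fun m => if ι m = i then 1 else 0)]
    simp
  rw [h2] at h
  rcases Int.units_eq_one_or (Equiv.Perm.sign π) with h3 | h3 <;> rw [h3]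
  · simpa using h
  · simpa using h.neg

end BM


namespace BM
open MvPolynomial

lemma exists_mac {t : ℕ} (d : Fin (t+1) → ℕ) (hd : ∀ i, 1 ≤ d i) (i : Fin (t+1))
    (π : Equiv.Perm (Fin (t+1))) :
    ∃ Δ : MvPolynomial (U t d) ℤ, th t d Δ = 0 ∧
      (∃ n ≤ ∏ j ∈ Finset.univ.erase i, d j, IsWeightedHomogeneous (wt d i) Δ n) ∧
      aeval (fun u : U t d => (Pi.single (pw (π u.1) (d u.1)) (1:ℤ) : Mon t (d u.1) → ℤ) u.2) Δ
        = (1 : ℤ) := by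
  classical
  obtain ⟨n, hn⟩ : ∃ n, n = ∑ j, (d j - 1) + 1 := ⟨_, rfl⟩
  have key : ∀ m : Mon t n, ∃ j, d j ≤ m.1 (π j) ∧ (j = i → ∀ k, k ≠ i → m.1 (π k) < d k) := by
    intro m
    by_cases h : ∃ j, j ≠ i ∧ d j ≤ m.1 (π j)
    · obtain ⟨j, hj, hj2⟩ := h
      exact ⟨j, hj2, fun h => absurd h hj⟩
    · push Not at h
      refine ⟨i, ?_, fun _ => h⟩
      by_contra hlt
      push Not at hlt
      have h1 : ∑ j, m.1 (π j) = n := by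
        rw [Equiv.sum_comp π (fun j => m.1 j), ← Finsupp.degree_eq_sum]; exact m.2
      have h2 : ∑ j, m.1 (π j) ≤ ∑ j, (d j - 1) := by
        apply Finset.sum_le_sum
        intro j _
        by_cases hj : j = i
        · subst hj; omega
        · have := h j hj; omega
      omega
  choose ι hι1 hι2 using key
  have hs : ∀ m, (m.1 - Finsupp.single (π (ι m)) (d (ι m))) +
      Finsupp.single (π (ι m)) (d (ι m)) = m.1 := by
    intro m
    apply tsub_add_cancel_of_le
    rw [Finsupp.single_le_iff]
    exact hι1 m
  refine ⟨(mac (gen t d) ι (fun m => m.1 - Finsupp.single (π (ι m)) (d (ι m)))).det, ?_, ?_, ?_⟩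
  · apply mac_mem
    intro m
    have := congrArg Finsupp.degree (hs m)
    rw [map_add, Finsupp.degree_single, m.2] at this
    exact this
  · refine ⟨_, ?_, mac_hom i ι _⟩
    have hc : ∏ j ∈ Finset.univ.erase i, d j =
      Fintype.card (∀ j : {j // j ≠ i}, Fin (d j)) := by
      rw [Fintype.card_pi]
      simp only [Fintype.card_fin]
      rw [← Finset.prod_subtype (Finset.univ.erase i) (by simp) d]
    rw [hc, ← Fintype.card_subtype]
    refine Fintype.card_le_of_injective
      (fun m : {m // ι m = i} => fun j : {j // j ≠ i} =>
        (⟨m.1.1 (π j.1), hι2 m.1 m.2 j.1 j.2⟩ : Fin (d j))) ?_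
    intro m m' h
    have h1 : ∀ j, j ≠ i → m.1.1 (π j) = m'.1.1 (π j) := by
      intro j hj
      have := congrFun h ⟨j, hj⟩
      simpa using this
    have e : ∀ m : Mon t n, m.1 (π i) + ∑ j ∈ Finset.univ.erase i, m.1 (π j) = n := by
      intro m
      rw [Finset.add_sum_erase _ (fun j => m.1 (π j)) (Finset.mem_univ i)]
      rw [Equiv.sum_comp π (fun j => m.1 j), ← Finsupp.degree_eq_sum]; exact m.2
    have e1 := e m.1
    have e2 := e m'.1
    rw [Finset.sum_congr rfl (fun j hj => h1 j (Finset.ne_of_mem_erase hj))] at e1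
    apply Subtype.ext
    apply Subtype.ext
    ext j
    obtain ⟨k, rfl⟩ := π.surjective j
    by_cases hk : k = i
    · subst hk; omega
    · exact h1 k hk
  · have := map_mac_det (aeval (fun u : U t d =>
      (Pi.single (pw (π u.1) (d u.1)) (1:ℤ) : Mon t (d u.1) → ℤ) u.2)).toRingHom (gen t d) ι
      (fun m => m.1 - Finsupp.single (π (ι m)) (d (ι m)))
    simp only [AlgHom.toRingHom_eq_coe, RingHom.coe_coe] at this
    rw [this]
    convert Matrix.det_one (n := Mon t n) (R := ℤ)
    ext m m'
    simp only [mac, macE, Matrix.of_apply, gen, aeval_X]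
    have e : pf (fun m_1 : Mon t (d (ι m)) => (Pi.single (pw (π (ι m)) (d (ι m))) (1:ℤ) :
      Mon t (d (ι m)) → ℤ) m_1) = monomial (Finsupp.single (π (ι m)) (d (ι m))) 1 := pf_single _ _
    rw [e, monomial_mul, hs, coeff_monomial, Matrix.one_apply]
    simp only [mul_one]
    congr 1
    exact propext ⟨fun h => Subtype.ext h, fun h => congrArg _ h⟩

lemma tau_monomial {σ : Type*} (w : σ → ℕ) (s : σ →₀ ℕ) (a : ℤ) :
    aeval (fun u => Polynomial.C (X u) * Polynomial.X ^ w u : σ → Polynomial (MvPolynomial σ ℤ))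
      (monomial s a) = Polynomial.monomial (Finsupp.weight w s) (monomial s a) := by
  have h1 : algebraMap ℤ (Polynomial (MvPolynomial σ ℤ)) a = Polynomial.C (C a) := by
    simp
  rw [aeval_monomial, h1, Finsupp.weight_apply, ← Polynomial.C_mul_X_pow_eq_monomial, monomial_eq,
    Polynomial.C_mul, mul_assoc]
  apply congrArg (fun z => Polynomial.C (C a) * z)
  rw [Finsupp.prod, Finsupp.prod, Finsupp.sum, map_prod, ← Finset.prod_pow_eq_pow_sum,
    ← Finset.prod_mul_distrib]
  apply Finset.prod_congr rfl
  intro x _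
  rw [mul_pow, map_pow, ← pow_mul, smul_eq_mul, mul_comm (w x)]

/-- divisors of weighted homogeneous are weighted homogeneous -/
lemma hom_of_dvd {σ : Type*} (w : σ → ℕ) (p q : MvPolynomial σ ℤ) (n : ℕ)
    (hpq : p ∣ q) (hq : q ≠ 0) (hh : IsWeightedHomogeneous w q n) :
    ∃ e ≤ n, IsWeightedHomogeneous w p e := by
  classical
  let τ : MvPolynomial σ ℤ →ₐ[ℤ] Polynomial (MvPolynomial σ ℤ) :=
    aeval (fun u => Polynomial.C (X u) * Polynomial.X ^ w u)
  have hmon : ∀ s a, τ (monomial s a) = Polynomial.monomial (Finsupp.weight w s) (monomial s a) := by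
    intro s a
    exact tau_monomial w s a
  have hτ : ∀ p : MvPolynomial σ ℤ, ∀ k s, ((τ p).coeff k).coeff s =
      if Finsupp.weight w s = k then p.coeff s else 0 := by
    intro p k s
    induction p using MvPolynomial.induction_on' with
    | monomial u a =>
      rw [hmon, Polynomial.coeff_monomial]
      by_cases h1 : u = s
      · subst h1
        split_ifs <;> simp
      · rw [coeff_monomial, if_neg h1]
        split_ifs <;> simp [coeff_monomial, h1]
    | add p q hp hq =>
      rw [map_add, Polynomial.coeff_add, coeff_add, hp, hq]
      split_ifs <;> simp
  have hq' : τ q = Polynomial.monomial n q := by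
    ext k s
    rw [hτ, Polynomial.coeff_monomial]
    by_cases hz : coeff s q = 0
    · split_ifs <;> simp [hz]
    · rw [hh hz]
      split_ifs <;> simp
  obtain ⟨r, hr⟩ := hpq
  have hmul : τ p * τ r = Polynomial.monomial n q := by
    rw [← hq', hr, map_mul]
  have hne : Polynomial.monomial n q ≠ 0 := by simpa using hq
  have hp0 : τ p ≠ 0 := by
    intro h; rw [h, zero_mul] at hmul; exact hne hmul.symm
  have hr0 : τ r ≠ 0 := by
    intro h; rw [h, mul_zero] at hmul; exact hne hmul.symm
  have d1 := congrArg Polynomial.natDegree hmul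
  have d2 := congrArg Polynomial.natTrailingDegree hmul
  rw [Polynomial.natDegree_mul hp0 hr0, Polynomial.natDegree_monomial_eq _ hq] at d1
  rw [Polynomial.natTrailingDegree_mul hp0 hr0, Polynomial.natTrailingDegree_monomial hq] at d2
  have d3 := Polynomial.natTrailingDegree_le_natDegree (τ p)
  have d4 := Polynomial.natTrailingDegree_le_natDegree (τ r)
  refine ⟨(τ p).natDegree, by omega, ?_⟩
  intro s hs
  have h5 := hτ p (Finsupp.weight w s) s
  rw [if_pos rfl] at h5
  have h6 : (τ p).coeff (Finsupp.weight w s) ≠ 0 := by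
    intro h; rw [h] at h5; exact hs h5.symm
  have h7 := Polynomial.le_natDegree_of_ne_zero h6
  have h8 := Polynomial.natTrailingDegree_le_of_ne_zero h6
  omega

/-- a nonzero prime of `A[X]` meeting `A` trivially is principal -/
lemma principal_aux {A : Type*} [CommRing A] [IsDomain A] [UniqueFactorizationMonoid A]
    (𝔭 : Ideal (Polynomial A)) [h𝔭 : 𝔭.IsPrime] (h0 : 𝔭 ≠ ⊥)
    (hA : ∀ a : A, Polynomial.C a ∈ 𝔭 → a = 0) :
    ∃ R : Polynomial A, R ≠ 0 ∧ ∀ f, f ∈ 𝔭 ↔ R ∣ f := by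
  classical
  obtain ⟨R, hR, hRp⟩ := Ideal.IsPrime.exists_mem_prime_of_ne_bot h𝔭 h0
  refine ⟨R, hRp.ne_zero, fun f => ⟨fun hf => ?_, fun hf => 𝔭.mem_of_dvd hf hR⟩⟩
  have hprim : R.IsPrimitive := by
    apply hRp.irreducible.isPrimitive
    intro h
    have := Polynomial.eq_C_of_natDegree_eq_zero h
    rw [this] at hR
    have h2 := hA _ hR
    rw [h2] at this
    exact hRp.ne_zero (by simpa using this)
  let _ : NormalizedGCDMonoid A := Classical.choice (inferInstance : Nonempty (NormalizedGCDMonoid A))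
  let F := FractionRing A
  rw [hprim.dvd_iff_fraction_map_dvd_fraction_map (K := F)]
  by_contra hnd
  have hirr := (hprim.irreducible_iff_irreducible_map_fraction_map (K := F)).1 hRp.irreducible
  have hcop := (hirr.coprime_iff_not_dvd).2 hnd
  obtain ⟨a, b, hab⟩ := hcop
  obtain ⟨s, hs, hs2⟩ := IsLocalization.integerNormalization_spec (nonZeroDivisors A) a
  obtain ⟨s', hs', hs2'⟩ := IsLocalization.integerNormalization_spec (nonZeroDivisors A) b
  have inj : Function.Injective (Polynomial.map (algebraMap A F)) :=
    Polynomial.map_injective _ (IsFractionRing.injective A F)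
  have e : IsLocalization.integerNormalization (nonZeroDivisors A) a * Polynomial.C s' * R
      + IsLocalization.integerNormalization (nonZeroDivisors A) b * Polynomial.C s * f
      = Polynomial.C (s * s') := by
    apply inj
    simp only [Polynomial.map_add, Polynomial.map_mul, Polynomial.map_C, hs2, hs2', map_mul]
    have k1 : s • a = Polynomial.C (algebraMap A F s) * a := by
      rw [← Polynomial.smul_eq_C_mul, algebraMap_smul]
    have k2 : s' • b = Polynomial.C (algebraMap A F s') * b := by
      rw [← Polynomial.smul_eq_C_mul, algebraMap_smul]
    rw [k1, k2]
    linear_combination (Polynomial.C (algebraMap A F s) * Polynomial.C (algebraMap A F s')) * hab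
  have hmem : Polynomial.C (s * s') ∈ 𝔭 := by
    rw [← e]
    exact 𝔭.add_mem (𝔭.mul_mem_left _ hR) (𝔭.mul_mem_left _ hf)
  exact nonZeroDivisors.ne_zero (mul_mem hs hs') (hA _ hmem)

end BM


namespace BM
open MvPolynomial

lemma chain_rule {σ τ : Type*} [Fintype σ] [DecidableEq σ] (g : σ → MvPolynomial τ ℤ) (v : τ)
    (f : MvPolynomial σ ℤ) :
    pderiv v (aeval g f) = ∑ w, aeval g (pderiv w f) * pderiv v (g w) := by
  induction f using MvPolynomial.induction_on with
  | C a => simp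
  | add p q hp hq => simp only [map_add, hp, hq, add_mul, Finset.sum_add_distrib]
  | mul_X p n hp =>
    simp only [map_mul, aeval_X, pderiv_mul, map_add, hp, add_mul, Finset.sum_add_distrib,
      Finset.sum_mul]
    congr 1
    · apply Finset.sum_congr rfl
      intro w _
      ring
    · rw [Finset.sum_eq_single n]
      · simp
      · intro b _ hb
        simp [pderiv_X_of_ne hb.symm]
      · simp

lemma totalDegree_pderiv_le' {σ : Type*} (f : MvPolynomial σ ℤ) (n : ℕ)
    (hf : f.totalDegree ≤ n + 1) (i : σ) : (pderiv i f).totalDegree ≤ n := by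
  unfold totalDegree
  refine Finset.sup_le fun m hm => ?_
  have h : m + Finsupp.single i 1 ∈ f.support := by
    rw [mem_support_iff] at hm ⊢
    intro h
    apply hm
    rw [coeff_pderiv, h, zero_mul]
  have := le_totalDegree h
  have h2 : (m + Finsupp.single i 1).degree = m.degree + 1 := by simp
  have h3 : (m + Finsupp.single i 1).degree ≤ f.totalDegree := by
    exact this
  have h4 : m.degree ≤ n := by omega
  exact h4

lemma eq_C_of_pderiv {σ : Type*} (f : MvPolynomial σ ℤ) (hf : ∀ i, pderiv i f = 0) :
    f = C (coeff 0 f) := by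
  classical
  ext m
  rw [coeff_C]
  split_ifs with h
  · rw [h]
  · obtain ⟨i, hi⟩ : ∃ i, m i ≠ 0 := by
      by_contra! h2
      exact h (Finsupp.ext (fun i => (h2 i).symm))
    have h3 := coeff_pderiv (i := i) f (m - Finsupp.single i 1)
    have h4 : m - Finsupp.single i 1 + Finsupp.single i 1 = m := by
      apply tsub_add_cancel_of_le
      rw [Finsupp.single_le_iff]
      omega
    rw [hf, h4, coeff_zero] at h3
    rcases mul_eq_zero.1 h3.symm with h5 | h5
    · exact h5
    · exfalso
      norm_cast at h5

variable {t : ℕ} {d : Fin (t+1) → ℕ}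

noncomputable def c0 (d : Fin (t+1) → ℕ) (i : Fin (t+1)) : U t d := ⟨i, pw 0 (d i)⟩

lemma thv_eq (u : U t d) : thv t d u = X (Sum.inl u) - if u = c0 d u.1 then gF t d u.1 else 0 := by
  rfl

lemma pderiv_gx_inl (v : U t d) (m) : pderiv (Sum.inl v) (mpow (gx t d) m) = 0 := by
  unfold mpow
  have : ∀ j, pderiv (Sum.inl v) (gx t d j) = 0 := by
    intro j
    refine Fin.cases ?_ (fun j => ?_) j
    · simp [gx]
    · simp only [gx, Fin.cons_succ]
      rw [pderiv_X_of_ne (by simp)]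
  induction (Finset.univ : Finset (Fin (t+1))) using Finset.induction_on with
  | empty => simp
  | insert a s ha ih => rw [Finset.prod_insert ha, pderiv_mul, ih, pderiv_pow, this]; simp

lemma pderiv_gF_inl (v : U t d) (i : Fin (t+1)) :
    pderiv (Sum.inl v) (gF t d i) = if v.1 = i then mpow (gx t d) v.2.1 else 0 := by
  unfold gF ev
  rw [map_sum]
  simp only [pderiv_mul, pderiv_gx_inl, mul_zero, add_zero]
  obtain ⟨k, m⟩ := v
  split_ifs with h
  · simp only at h
    subst h
    rw [Finset.sum_eq_single m]
    · simp
    · intro b _ hb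
      rw [pderiv_X_of_ne, zero_mul]
      intro h
      apply hb
      simpa using h
    · simp
  · apply Finset.sum_eq_zero
    intro b _
    rw [pderiv_X_of_ne, zero_mul]
    intro h'
    apply h
    have := Sum.inl_injective h'
    exact (congrArg Sigma.fst this).symm

lemma sum_c0 {M : Type*} [AddCommMonoid M] (g : U t d → M) :
    ∑ w : U t d, (if w = c0 d w.1 then g w else 0) = ∑ i, g (c0 d i) := by
  classical
  rw [Fintype.sum_sigma]
  apply Finset.sum_congr rfl
  intro i _
  rw [Finset.sum_eq_single (pw 0 (d i))]
  · rw [if_pos]; rfl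
    rfl
  · intro b _ hb
    rw [if_neg]
    intro h
    apply hb
    simpa [c0] using h
  · simp

lemma th_pderiv (f : MvPolynomial (U t d) ℤ) (hf : th t d f = 0) (v : U t d) :
    th t d (pderiv v f) = th t d (pderiv (c0 d v.1) f) * mpow (gx t d) v.2.1 := by
  classical
  have h := chain_rule (thv t d) (Sum.inl v) f
  have hf' : aeval (thv t d) f = 0 := hf
  rw [hf', map_zero] at h
  have h2 : ∀ w, aeval (thv t d) (pderiv w f) * pderiv (Sum.inl v) (thv t d w) =
      (if w = v then aeval (thv t d) (pderiv w f) else 0) -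
      (if w = c0 d w.1 then (if v.1 = w.1 then
        aeval (thv t d) (pderiv w f) * mpow (gx t d) v.2.1 else 0) else 0) := by
    intro w
    rw [thv_eq, map_sub, mul_sub]
    congr 1
    · by_cases hw : w = v
      · subst hw; simp
      · rw [pderiv_X_of_ne, if_neg hw, mul_zero]
        simpa using hw
    · split_ifs with h1 h2
      · rw [pderiv_gF_inl, if_pos h2]
      · rw [pderiv_gF_inl, if_neg h2, mul_zero]
      · simp
  simp only [h2] at h
  rw [Finset.sum_sub_distrib, sum_c0 (fun w => (if v.1 = w.1 then
        aeval (thv t d) (pderiv w f) * mpow (gx t d) v.2.1 else 0))] at h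
  rw [Finset.sum_eq_single v.1 (by
    intro b _ hb
    exact if_neg (Ne.symm hb)) (by simp)] at h
  simp only [Finset.sum_ite_eq', Finset.mem_univ, if_true] at h
  rw [if_pos (show v.1 = (c0 d v.1).1 from rfl)] at h
  exact (sub_eq_zero.1 h.symm)

lemma th_pderiv_inr (f : MvPolynomial (U t d) ℤ) (hf : th t d f = 0) (j : Fin t) :
    ∑ i, th t d (pderiv (c0 d i) f) * pderiv (Sum.inr j) (gF t d i) = 0 := by
  classical
  have h := chain_rule (thv t d) (Sum.inr j) f
  have hf' : aeval (thv t d) f = 0 := hf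
  rw [hf', map_zero] at h
  have h2 : ∀ w, aeval (thv t d) (pderiv w f) * pderiv (Sum.inr j) (thv t d w) =
      - (if w = c0 d w.1 then 
        aeval (thv t d) (pderiv w f) * pderiv (Sum.inr j) (gF t d w.1) else 0) := by
    intro w
    rw [thv_eq, map_sub, mul_sub, pderiv_X_of_ne (by simp)]
    split_ifs <;> simp
  simp only [h2] at h
  rw [Finset.sum_neg_distrib, sum_c0 (fun w => 
        aeval (thv t d) (pderiv w f) * pderiv (Sum.inr j) (gF t d w.1))] at h
  exact neg_eq_zero.1 h.symm

noncomputable def lm (hd : ∀ i, 1 ≤ d i) (i : Fin (t+1)) : Mon t (d i) :=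
  ⟨Finsupp.single 0 (d i - 1) + Finsupp.single i 1, by
    rw [map_add, Finsupp.degree_single, Finsupp.degree_single]
    have := hd i; omega⟩

lemma jac_ne (hd : ∀ i, 1 ≤ d i) :
    (Matrix.of fun j i : Fin t => pderiv (Sum.inr j) (gF t d i.succ)).det ≠ 0 := by
  classical
  let g : U t d ⊕ Fin t → MvPolynomial (Fin t) ℤ :=
    Sum.elim (fun u => if u.2 = lm hd u.1 then 1 else 0) X
  intro h
  have h1 := congrArg (aeval g).toRingHom h
  rw [RingHom.map_det, map_zero] at h1
  have hg : ∀ i : Fin t, aeval g (gF t d i.succ) = X i := by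
    intro i
    have := map_ev (aeval g).toRingHom
      (fun m : Mon t (d i.succ) => X (Sum.inl ⟨i.succ, m⟩)) (gx t d)
    simp only [AlgHom.toRingHom_eq_coe, RingHom.coe_coe, aeval_X, g, Sum.elim_inl] at this
    unfold gF
    rw [this]
    unfold ev
    rw [Finset.sum_eq_single (lm hd i.succ)]
    · dsimp only
      rw [if_pos rfl, one_mul]
      unfold mpow lm
      dsimp only
      rw [Fin.prod_univ_succ, Finset.prod_eq_single i]
      · simp [gx]
      · intro b _ hb
        simp [Finsupp.single_apply, hb.symm]
      · simp
    · intro b _ hb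
      dsimp only
      rw [if_neg hb, zero_mul]
    · simp
  have h2 : ∀ (j : Fin t) (p : MvPolynomial (U t d ⊕ Fin t) ℤ),
      aeval g (pderiv (Sum.inr j) p) = pderiv j (aeval g p) := by
    intro j p
    rw [chain_rule, Finset.sum_eq_single (Sum.inr j)]
    · simp [g]
    · rintro (b | b) _ hb
      · simp only [g, Sum.elim_inl]
        split_ifs <;> simp
      · simp only [g, Sum.elim_inr]
        rw [pderiv_X_of_ne, mul_zero]
        rintro rfl
        exact hb rfl
    · simp
  have h3 : (aeval g).toRingHom.mapMatrix
      (Matrix.of fun j i : Fin t => pderiv (Sum.inr j) (gF t d i.succ)) = 1 := by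
    ext1 j i
    simp only [AlgHom.toRingHom_eq_coe, RingHom.mapMatrix_apply, Matrix.map_apply, Matrix.of_apply,
      RingHom.coe_coe, h2, hg, Matrix.one_apply]
    split_ifs with hij
    · subst hij; simp
    · rw [pderiv_X_of_ne (Ne.symm hij)]
  rw [h3, Matrix.det_one] at h1
  exact one_ne_zero h1

lemma J_zero (hd : ∀ i, 1 ≤ d i) (n : ℕ) : ∀ f : MvPolynomial (U t d) ℤ, f.totalDegree ≤ n →
    th t d f = 0 → pderiv (c0 d 0) f = 0 → f = 0 := by
  have hC : ∀ a : ℤ, th t d (C a) = 0 → a = 0 := by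
    intro a h
    simpa [th] using h
  induction n with
  | zero =>
    intro f hf h1 _
    have := (totalDegree_eq_zero_iff_eq_C (p := f)).1 (by omega)
    rw [this] at h1 ⊢
    rw [hC _ h1, C_0]
  | succ n ih =>
    intro f hf h1 h2
    have hall : ∀ i, th t d (pderiv (c0 d i) f) = 0 := by
      have h0 : th t d (pderiv (c0 d 0) f) = 0 := by rw [h2, map_zero]
      have hv : (Matrix.of fun j i : Fin t => pderiv (Sum.inr j) (gF t d i.succ)).mulVec
        (fun i => th t d (pderiv (c0 d i.succ) f)) = 0 := by
        ext1 j
        have := th_pderiv_inr f h1 j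
        rw [Fin.sum_univ_succ, h0, zero_mul, zero_add] at this
        simp only [Matrix.mulVec, dotProduct, Matrix.of_apply, Pi.zero_apply]
        rw [← this]
        exact Finset.sum_congr rfl fun i _ => mul_comm _ _
      have hz : (fun i : Fin t => th t d (pderiv (c0 d i.succ) f)) = 0 := by
        by_contra hne
        exact jac_ne hd (Matrix.exists_mulVec_eq_zero_iff.1 ⟨_, hne, hv⟩)
      intro i
      refine Fin.cases h0 (fun i => congrFun hz i) i
    have hall2 : ∀ v, pderiv v f = 0 := by
      intro v
      apply ih _ (totalDegree_pderiv_le' f n hf v)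
      · rw [th_pderiv f h1 v, hall, zero_mul]
      · have : pderiv (c0 d 0) (pderiv v f) = pderiv v (pderiv (c0 d 0) f) := by
          classical
          ext m
          simp only [coeff_pderiv, add_assoc, add_comm (Finsupp.single v 1)]
          by_cases hv : v = c0 d 0
          · rw [hv]
          · simp [Finsupp.single_apply, hv, Ne.symm hv]
            ring
        rw [this, h2, map_zero]
    have := eq_C_of_pderiv f hall2
    rw [this] at h1 ⊢
    rw [hC _ h1, C_0]

theorem exists_res (hd : ∀ i, 1 ≤ d i) : ∃ R : MvPolynomial (U t d) ℤ, R ≠ 0 ∧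
    ∀ f, th t d f = 0 ↔ R ∣ f := by
  classical
  let S := {u : U t d // u ≠ c0 d 0}
  let e : Polynomial (MvPolynomial S ℤ) ≃ₐ[ℤ] MvPolynomial (U t d) ℤ :=
    (optionEquivLeft ℤ S).symm.trans (renameEquiv ℤ (Equiv.optionSubtypeNe (c0 d 0)))
  have heC : ∀ a : MvPolynomial S ℤ, e (Polynomial.C a) = rename Subtype.val a := by
    intro a
    induction a using MvPolynomial.induction_on with
    | C a => simp [e]
    | add p q hp hq => rw [map_add, map_add, map_add, hp, hq]
    | mul_X p n hp =>
      rw [map_mul, map_mul, map_mul, hp]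
      congr 1
      simp [e]
      exact Equiv.optionSubtypeNe_some _ n
  let 𝔭 : Ideal (Polynomial (MvPolynomial S ℤ)) :=
    RingHom.ker ((th t d).toRingHom.comp e.toRingEquiv.toRingHom)
  have hmem : ∀ g, g ∈ 𝔭 ↔ th t d (e g) = 0 := by
    intro g
    rfl
  have : 𝔭.IsPrime := RingHom.ker_isPrime _
  obtain ⟨Δ, h1, -, h3⟩ := exists_mac d hd 0 1
  have hΔ : Δ ≠ 0 := by
    rintro rfl
    simp at h3
  have hne : 𝔭 ≠ ⊥ := by
    intro h
    have h4 : e.symm Δ ∈ 𝔭 := by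
      rw [hmem]; simpa using h1
    rw [h, Ideal.mem_bot] at h4
    simp at h4
    exact hΔ h4
  obtain ⟨R, hR0, hR⟩ := principal_aux 𝔭 hne (by
    intro a ha
    rw [hmem, heC] at ha
    have := J_zero hd _ (rename Subtype.val a) le_rfl ha (by
      apply pderiv_eq_zero_of_notMem_vars
      intro h
      have := vars_rename _ _ h
      simp at this)
    exact (map_eq_zero_iff _ (rename_injective _ Subtype.val_injective)).1 this)
  refine ⟨e R, by simpa using hR0, fun f => ?_⟩
  have := hR (e.symm f)
  rw [hmem] at this
  rw [AlgEquiv.apply_symm_apply] at this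
  rw [this]
  constructor
  · rintro ⟨g, hg⟩
    refine ⟨e g, ?_⟩
    rw [← map_mul, ← hg, AlgEquiv.apply_symm_apply]
  · rintro ⟨g, hg⟩
    refine ⟨e.symm g, ?_⟩
    rw [hg, map_mul, AlgEquiv.symm_apply_apply]

end BM


namespace BM
open MvPolynomial

section
variable {t : ℕ} {d : Fin (t+1) → ℕ}

def IsRes (R : MvPolynomial (U t d) ℤ) : Prop := R ≠ 0 ∧ ∀ f, th t d f = 0 ↔ R ∣ f

noncomputable def rv {A : Type*} [CommRing A] (R : MvPolynomial (U t d) ℤ)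
    (c : ∀ i, Mon t (d i) → A) : A := aeval (fun u : U t d => c u.1 u.2) R

lemma rv_map {A B : Type*} [CommRing A] [CommRing B] (φ : A →+* B) (R : MvPolynomial (U t d) ℤ)
    (c : ∀ i, Mon t (d i) → A) : φ (rv R c) = rv R (fun i m => φ (c i m)) := by
  unfold rv
  have : ((φ.toIntAlgHom).comp (aeval (fun u : U t d => c u.1 u.2))) =
    aeval (fun u : U t d => φ (c u.1 u.2)) := by
    ext u; simp
  rw [← this]; rfl

lemma rv_eq_eval {A : Type*} [CommRing A] (R : MvPolynomial (U t d) ℤ)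
    (c : ∀ i, Mon t (d i) → A) :
    rv R c = eval (fun u : U t d => c u.1 u.2) (map (Int.castRingHom A) R) := by
  rw [rv, eval_map]; rfl

lemma rv_continuous (R : MvPolynomial (U t d) ℤ) :
    Continuous (fun c : ∀ i, Mon t (d i) → ℂ => rv R c) := by
  simp only [rv_eq_eval]
  exact (MvPolynomial.continuous_eval _).comp (by fun_prop)

lemma ev_continuous {n : ℕ} (c : Mon t n → ℂ) : Continuous (ev c) := by
  unfold ev mpow
  fun_prop

lemma rv_zero_one {R : MvPolynomial (U t d) ℤ} (hR : IsRes R) (c : ∀ i, Mon t (d i) → ℂ)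
    (x : Fin (t+1) → ℂ) (hx : x 0 = 1) (hc : ∀ i, ev (c i) x = 0) : rv R c = 0 := by
  have h0 : th t d R = 0 := (hR.2 R).2 dvd_rfl
  let φ : MvPolynomial (U t d ⊕ Fin t) ℤ →ₐ[ℤ] ℂ :=
    aeval (Sum.elim (fun u => c u.1 u.2) (fun j => x j.succ))
  have h1 : φ.comp (th t d) = aeval (fun u : U t d => c u.1 u.2) := by
    ext u
    have hgF : φ (gF t d u.1) = 0 := by
      have := map_ev φ.toRingHom
        (fun m : Mon t (d u.1) => X (Sum.inl ⟨u.1, m⟩)) (gx t d)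
      unfold gF
      refine this.trans ?_
      rw [← hc u.1]
      congr 1
      · ext m
        simp [φ]
      · ext j
        refine Fin.cases ?_ (fun j => ?_) j
        · simp [gx, hx]
        · simp [gx, φ]
    simp only [AlgHom.comp_apply, th, aeval_X, thv, map_sub]
    rw [apply_ite φ, hgF]
    simp [φ]
  have h2 := congrArg φ h0
  rw [map_zero, ← AlgHom.comp_apply, h1] at h2
  exact h2

lemma rv_zero {R : MvPolynomial (U t d) ℤ} (hR : IsRes R) (c : ∀ i, Mon t (d i) → ℂ)
    (x : Fin (t+1) → ℂ) (hx : x ≠ 0) (hc : ∀ i, ev (c i) x = 0) : rv R c = 0 := by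
  have key : ∀ (c : ∀ i, Mon t (d i) → ℂ) (x : Fin (t+1) → ℂ), x 0 ≠ 0 →
      (∀ i, ev (c i) x = 0) → rv R c = 0 := by
    intro c x hx hc
    refine rv_zero_one hR c ((x 0)⁻¹ • x) (by simp [hx]) fun i => ?_
    rw [ev_smul_right, hc, mul_zero]
  by_cases h0 : x 0 = 0
  swap
  · exact key c x h0 hc
  obtain ⟨j, hj⟩ := Function.ne_iff.1 hx
  simp only [Pi.zero_apply] at hj
  have hj0 : j ≠ 0 := by rintro rfl; exact hj h0
  let y : ℂ → Fin (t+1) → ℂ := fun ε => Function.update x 0 ε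
  have hy0 : y 0 = x := by
    simp only [y]; rw [← h0]; exact Function.update_eq_self 0 x
  have hyc : Continuous y := by
    exact continuous_const.update 0 continuous_id
  let C : ℂ → ∀ i, Mon t (d i) → ℂ := fun ε i =>
    c i - (ev (c i) (y ε) / x j ^ d i) • Pi.single (pw j (d i)) 1
  have hC : Continuous C := by
    refine continuous_pi fun i => ?_
    refine continuous_const.sub ?_
    exact (((ev_continuous (c i)).comp hyc).div_const _).smul continuous_const
  have hC0 : C 0 = c := by
    funext i
    simp only [C, hy0, hc]
    simp
  have h1 : Set.EqOn (fun ε => rv R (C ε)) (fun _ => 0) {0}ᶜ := by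
    intro ε hε
    apply key (C ε) (y ε)
    · simpa [y] using hε
    · intro i
      simp only [C, ev_sub, ev_smul, ev_single]
      have : y ε j = x j := by simp [y, hj0]
      rw [this]
      field_simp
      simp
  have h2 := Continuous.ext_on (dense_compl_singleton (0:ℂ)) ((rv_continuous R).comp hC)
    continuous_const h1
  have := congrFun h2 0
  simpa [hC0] using this

/-- coefficient vector -/
noncomputable def cv (t n : ℕ) : MvPolynomial (Fin (t+1)) ℂ →ₗ[ℂ] (Mon t n → ℂ) :=
  LinearMap.pi fun m => lcoeff ℂ m.1

lemma exists_minor (c : ∀ i, Mon t (d i) → ℂ)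
    (hc : ∀ x, (∀ i, ev (c i) x = 0) → x = 0) :
    ∃ (n : ℕ) (ι : Mon t n → Fin (t+1)) (s : Mon t n → (Fin (t+1) →₀ ℕ)),
      (∀ m, (s m).degree + d (ι m) = n) ∧ (mac c ι s).det ≠ 0 := by
  classical
  let I : Ideal (MvPolynomial (Fin (t+1)) ℂ) := Ideal.span (Set.range fun i => pf (c i))
  have h1 : ∀ j, ∃ N, (X j : MvPolynomial (Fin (t+1)) ℂ) ^ N ∈ I := by
    intro j
    have : (X j : MvPolynomial (Fin (t+1)) ℂ) ∈ I.radical := by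
      rw [← vanishingIdeal_zeroLocus_eq_radical (K := ℂ), mem_vanishingIdeal_iff]
      intro x hx
      rw [mem_zeroLocus_iff] at hx
      have := hc x (fun i => by
        have := hx (pf (c i)) (Ideal.subset_span ⟨i, rfl⟩)
        rwa [← eval_pf, ← MvPolynomial.coe_aeval_eq_eval])
      simp [this]
    exact this
  choose N0 hN0 using h1
  let N := ∑ j, N0 j
  have hN : ∀ j, (X j : MvPolynomial (Fin (t+1)) ℂ) ^ N ∈ I := fun j =>
    Ideal.pow_mem_of_pow_mem _ (hN0 j) (Finset.single_le_sum (fun _ _ => Nat.zero_le _)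
      (Finset.mem_univ j))
  let n := (t+1) * N
  let Row := {p : Fin (t+1) × (Fin (t+1) →₀ ℕ) // p.2.degree + d p.1 = n}
  let v : Row → Mon t n → ℂ := fun p m => macE c p.1.1 p.1.2 m.1
  have hI : ∀ p ∈ I, ∀ g, cv t n (g * p) ∈ Submodule.span ℂ (Set.range v) := by
    intro p hp
    refine Submodule.span_induction ?_ ?_ ?_ ?_ hp
    · rintro _ ⟨i, rfl⟩ g
      rw [g.as_sum, Finset.sum_mul, map_sum]
      refine Submodule.sum_mem _ fun s _ => ?_
      have h3 : monomial s (coeff s g) = coeff s g • monomial s (1:ℂ) := by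
        rw [smul_monomial, smul_eq_mul, mul_one]
      rw [h3, smul_mul_assoc, map_smul]
      refine Submodule.smul_mem _ _ ?_
      by_cases hs : s.degree + d i = n
      · exact Submodule.subset_span ⟨⟨(i, s), hs⟩, rfl⟩
      · have h4 : cv t n (monomial s (1:ℂ) * pf (c i)) = 0 := by
          ext m
          have h5 := (isHomogeneous_monomial (1 : ℂ) (d := s) rfl).mul (pf_hom (c i))
          exact h5.coeff_eq_zero (by rw [m.2]; exact Ne.symm hs)
        rw [h4]; exact Submodule.zero_mem _
    · intro g; simp
    · intro x y _ _ hx hy g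
      rw [mul_add, map_add]
      exact Submodule.add_mem _ (hx g) (hy g)
    · intro a x _ hx g
      rw [smul_eq_mul, ← mul_assoc]
      exact hx _
  have hmon : ∀ m : Mon t n, monomial m.1 (1:ℂ) ∈ I := by
    intro m
    obtain ⟨j, hj⟩ : ∃ j, N ≤ m.1 j := by
      by_contra! h
      have h2 := m.2
      rw [Finsupp.degree_eq_sum] at h2
      have h3 := Finset.sum_lt_sum_of_nonempty (s := (Finset.univ : Finset (Fin (t+1))))
        Finset.univ_nonempty (fun j _ => h j)
      rw [h2] at h3
      simp [n] at h3
    have : monomial m.1 (1:ℂ) = monomial (m.1 - Finsupp.single j N) 1 * X j ^ N := by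
      rw [X_pow_eq_monomial, monomial_mul, mul_one, tsub_add_cancel_of_le]
      rw [Finsupp.single_le_iff]
      exact hj
    rw [this]
    exact Ideal.mul_mem_left _ _ (hN j)
  have hspan : Submodule.span ℂ (Set.range v) = ⊤ := by
    rw [eq_top_iff, ← (Pi.basisFun ℂ (Mon t n)).span_eq, Submodule.span_le]
    rintro _ ⟨m, rfl⟩
    have := hI _ (hmon m) 1
    rw [one_mul] at this
    have h6 : Pi.basisFun ℂ (Mon t n) m = cv t n (monomial m.1 1) := by
      funext k
      simp only [Pi.basisFun_apply, cv, LinearMap.pi_apply, lcoeff_apply, coeff_monomial]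
      rw [Pi.single_apply]
      by_cases hk : k = m
      · subst hk; simp
      · rw [if_neg hk, if_neg]
        intro h
        exact hk (Subtype.ext h.symm)
    rw [h6]
    exact this
  obtain ⟨κ, a, ha, hs, hli⟩ := exists_linearIndependent' ℂ v
  rw [hspan] at hs
  let b := Module.Basis.mk hli hs.ge
  let e := (Pi.basisFun ℂ (Mon t n)).indexEquiv b
  refine ⟨n, fun m => (a (e m)).1.1, fun m => (a (e m)).1.2, fun m => (a (e m)).2, ?_⟩
  have h5 : LinearIndependent ℂ (mac c (fun m : Mon t n => (a (e m)).1.1)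
      (fun m => (a (e m)).1.2)).row := by
    exact hli.comp e e.injective
  rw [Matrix.linearIndependent_rows_iff_isUnit, Matrix.isUnit_iff_isUnit_det] at h5
  exact h5.ne_zero

lemma rv_ne_zero {R : MvPolynomial (U t d) ℤ} (hR : IsRes R) (c : ∀ i, Mon t (d i) → ℂ)
    (hc : ∀ x, (∀ i, ev (c i) x = 0) → x = 0) : rv R c ≠ 0 := by
  obtain ⟨n, ι, s, hs, hdet⟩ := exists_minor c hc
  have h1 := (hR.2 _).1 (mac_mem ι s hs)
  obtain ⟨g, hg⟩ := h1
  have h2 := map_mac_det (aeval (fun u : U t d => c u.1 u.2)).toRingHom (gen t d) ι s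
  intro h
  apply hdet
  have h3 : (fun i m => (aeval (fun u : U t d => c u.1 u.2)).toRingHom (gen t d i m)) = c := by
    funext i m
    simp [gen]
  rw [h3] at h2
  rw [← h2, hg, map_mul]
  have h4 : (aeval (fun u : U t d => c u.1 u.2)).toRingHom R = 0 := h
  rw [h4, zero_mul]

end
end BM


namespace BM
open MvPolynomial

lemma whom_aeval {σ A : Type*} [Fintype σ] [CommRing A] (w : σ → ℕ) (p : MvPolynomial σ ℤ) (e : ℕ)
    (hp : IsWeightedHomogeneous w p e) (a : A) (f : σ → A) :
    aeval (fun u => a ^ w u * f u) p = a ^ e * aeval f p := by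
  simp only [aeval_def, eval₂_eq', Finset.mul_sum]
  refine Finset.sum_congr rfl fun m hm => ?_
  have h := hp (mem_support_iff.1 hm)
  rw [Finsupp.weight_apply, Finsupp.sum_fintype _ _ (by simp)] at h
  simp only [smul_eq_mul] at h
  have h2 : ∏ i, (a ^ w i * f i) ^ m i = a ^ e * ∏ i, f i ^ m i := by
    simp only [mul_pow, Finset.prod_mul_distrib]
    congr 1
    rw [← h, ← Finset.prod_pow_eq_pow_sum]
    refine Finset.prod_congr rfl fun i _ => ?_
    rw [← pow_mul, mul_comm]
  rw [h2]; ring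

section
variable {t : ℕ} {d : Fin (t+1) → ℕ}

lemma res_hom {R : MvPolynomial (U t d) ℤ} (hR : IsRes R) (hd : ∀ i, 1 ≤ d i) (i : Fin (t+1)) :
    ∃ e ≤ ∏ j ∈ Finset.univ.erase i, d j, IsWeightedHomogeneous (wt d i) R e := by
  obtain ⟨Δ, h1, ⟨n, hn, h2⟩, h3⟩ := exists_mac d hd i 1
  obtain ⟨e, he, h⟩ := hom_of_dvd (wt d i) R Δ n ((hR.2 Δ).1 h1) (by rintro rfl; simp at h3) h2
  exact ⟨e, he.trans hn, h⟩

lemma res_perm {R : MvPolynomial (U t d) ℤ} (hR : IsRes R) (hd : ∀ i, 1 ≤ d i)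
    (π : Equiv.Perm (Fin (t+1))) :
    ‖rv R (fun i => Pi.single (pw (π i) (d i)) (1:ℂ))‖ = 1 := by
  obtain ⟨Δ, h1, -, h3⟩ := exists_mac d hd 0 π
  obtain ⟨g, hg⟩ := (hR.2 Δ).1 h1
  rw [hg, map_mul] at h3
  have h4 : rv R (fun i => Pi.single (pw (π i) (d i)) (1:ℂ)) =
      (Int.castRingHom ℂ) (rv R (fun i => (Pi.single (pw (π i) (d i)) (1:ℤ)))) := by
    rw [rv_map]
    congr 1
    funext i m
    by_cases h : m = pw (π i) (d i)
    · subst h; simp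
    · simp [Pi.single_eq_of_ne h]
  rw [h4]
  have h5 := Int.isUnit_iff.1 (IsUnit.of_mul_eq_one _ h3)
  unfold rv
  rcases h5 with h5 | h5 <;> rw [h5] <;> simp

lemma rv_update_smul {A : Type*} [CommRing A] {R : MvPolynomial (U t d) ℤ} {i : Fin (t+1)} {e : ℕ}
    (he : IsWeightedHomogeneous (wt d i) R e) (c : ∀ i, Mon t (d i) → A) (a : A) 
    (P : Mon t (d i) → A) :
    rv R (Function.update c i (a • P)) = a ^ e * rv R (Function.update c i P) := by
  unfold rv
  rw [← whom_aeval (wt d i) R e he]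
  congr 2
  funext ⟨j, m⟩
  by_cases h : j = i
  · subst h
    simp [wt]
  · simp [wt, h]

noncomputable def lf {n : ℕ} (α : Fin (t+1) → ℂ) : MvPolynomial (Mon t n) ℂ :=
  ∑ m, C (mpow α m.1) * X m

lemma eval_lf {n : ℕ} (α : Fin (t+1) → ℂ) (P : Mon t n → ℂ) : eval P (lf α) = ev P α := by
  simp [lf, ev, mul_comm]

lemma lf_prime {n : ℕ} (α : Fin (t+1) → ℂ) (hα : α ≠ 0) : Prime (lf (n := n) α) := by
  classical
  apply Irreducible.prime
  obtain ⟨j, hj⟩ := Function.ne_iff.1 hα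
  have hc : ∀ m : Mon t n, coeff (Finsupp.single m 1) (lf α) = mpow α m.1 := by
    intro m
    simp only [lf, coeff_sum, coeff_C_mul, coeff_X']
    rw [Finset.sum_eq_single m]
    · simp
    · intro b _ hb
      rw [if_neg, mul_zero]
      intro h
      exact hb (Finsupp.single_left_injective one_ne_zero h)
    · simp
  have hne : coeff (Finsupp.single (pw j n) 1) (lf α) ≠ 0 := by
    rw [hc]
    have := ev_single (n := n) j 1 α
    unfold mpow
    refine Finset.prod_ne_zero_iff.2 fun k _ => ?_
    by_cases hk : k = j
    · subst hk; exact pow_ne_zero _ hj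
    · simp [pw, Finsupp.single_apply, Ne.symm hk]
  apply irreducible_of_totalDegree_eq_one
  · apply IsHomogeneous.totalDegree
    · apply IsHomogeneous.sum
      intro m _
      have := (isHomogeneous_C (Mon t n) (mpow α m.1)).mul (isHomogeneous_X ℂ m)
      simpa using this
    · intro h
      rw [h] at hne
      simp at hne
  · intro x hx
    have := hx (Finsupp.single (pw j n) 1)
    rw [isUnit_iff_ne_zero]
    rintro rfl
    exact hne (zero_dvd_iff.1 this)

lemma ev_zero_right {n : ℕ} (hn : 1 ≤ n) (P : Mon t n → ℂ) : ev P 0 = 0 := by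
  have := ev_smul_right 0 P 0
  rw [zero_smul, zero_pow (by omega), zero_mul] at this
  exact this

lemma rv_update_poly (R : MvPolynomial (U t d) ℤ) (c : ∀ i, Mon t (d i) → ℂ) (i : Fin (t+1)) :
    ∃ f : MvPolynomial (Mon t (d i)) ℂ, ∀ P, eval P f = rv R (Function.update c i P) := by
  refine ⟨rv R (Function.update (fun j m => C (c j m)) i (fun m => X m)), fun P => ?_⟩
  rw [rv_map]
  congr 1
  funext j m
  by_cases h : j = i
  · subst h; simp
  · simp [h]

lemma Z_finite {R : MvPolynomial (U t d) ℤ} (hR : IsRes R) (hd : ∀ i, 1 ≤ d i)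
    (c : ∀ i, Mon t (d i) → ℂ) (hc : rv R c ≠ 0) (i : Fin (t+1)) :
    {α : Fin (t+1) → ℂ | (∀ j, j ≠ i → ev (c j) α = 0) ∧ ev (c i) α = 1}.Finite := by
  obtain ⟨e, -, he⟩ := res_hom hR hd i
  have h1 : ∀ k : Fin (t+1), ∃ g : Polynomial ℂ, g ≠ 0 ∧ ∀ b : ℂ,
      g.eval b = rv R (Function.update c i (b • Pi.single (pw k (d i)) 1 - c i)) := by
    intro k
    let g := rv R (Function.update (fun j m => Polynomial.C (c j m)) i
      ((Polynomial.X : Polynomial ℂ) • Pi.single (pw k (d i)) 1 - (fun m => Polynomial.C (c i m))))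
    have hg : ∀ b : ℂ,
      g.eval b = rv R (Function.update c i (b • Pi.single (pw k (d i)) 1 - c i)) := by
      intro b
      have := rv_map (Polynomial.evalRingHom b) R (Function.update (fun j m => Polynomial.C (c j m)) i
        ((Polynomial.X : Polynomial ℂ) • Pi.single (pw k (d i)) 1 - (fun m => Polynomial.C (c i m))))
      refine this.trans ?_
      congr 1
      funext j m
      by_cases h : j = i
      · subst h
        by_cases h' : m = pw k (d j)
        · subst h'; simp
        · simp [Pi.single_eq_of_ne h']
      · simp [h]
    refine ⟨g, ?_, hg⟩
    intro h0
    have := hg 0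
    rw [h0] at this
    have h3 : (0:ℂ) • (Pi.single (pw k (d i)) 1 : Mon t (d i) → ℂ) - c i = (-1 : ℂ) • c i := by
      simp
    rw [h3, rv_update_smul he, Function.update_eq_self] at this
    simp at this
    exact hc this
  choose g hg0 hg using h1
  have hfin : ∀ k, {z : ℂ | z = 0 ∨ (z ^ d i)⁻¹ ∈ (g k).rootSet ℂ}.Finite := by
    intro k
    refine Set.Finite.union (Set.finite_singleton 0) ?_
    have h2 : {z : ℂ | (z ^ d i)⁻¹ ∈ (g k).rootSet ℂ} ⊆
      ⋃ w ∈ (g k).rootSet ℂ, {z : ℂ | z ^ d i = w⁻¹} := by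
      intro z hz
      simp only [Set.mem_iUnion, Set.mem_setOf_eq]
      exact ⟨_, hz, by simp⟩
    refine Set.Finite.subset (Set.Finite.biUnion ((g k).rootSet_finite ℂ) fun w _ => ?_) h2
    refine Set.Finite.subset (Polynomial.nthRoots (d i) w⁻¹).toFinset.finite_toSet ?_
    intro z hz
    simp only [Finset.mem_coe, Multiset.mem_toFinset]
    rw [Polynomial.mem_nthRoots (by have := hd i; omega)]
    exact hz
  refine Set.Finite.subset (Set.Finite.pi' hfin) ?_
  rintro α ⟨hα1, hα2⟩ k
  by_cases hk : α k = 0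
  · exact Or.inl hk
  · right
    rw [Polynomial.mem_rootSet_of_ne (hg0 k)]
    rw [Polynomial.coe_aeval_eq_eval, hg]
    apply rv_zero hR _ α
    · intro h; rw [h] at hk; exact hk rfl
    · intro j
      by_cases h : j = i
      · subst h
        simp [ev_sub, ev_smul, ev_single, hα2, hk]
      · simp [h, hα1 j h]

theorem fact {R : MvPolynomial (U t d) ℤ} (hR : IsRes R) (hd : ∀ i, 1 ≤ d i)
    (c : ∀ i, Mon t (d i) → ℂ) (hc : rv R c ≠ 0) (i : Fin (t+1)) (e : ℕ)
    (he : IsWeightedHomogeneous (wt d i) R e) :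
    ∃ (a : ℂ) (α : Fin e → (Fin (t+1) → ℂ)), (∀ l, α l ≠ 0) ∧
      (∀ l j, j ≠ i → ev (c j) (α l) = 0) ∧
      ∀ P, rv R (Function.update c i P) = a * ∏ l, ev P (α l) := by
  classical
  obtain ⟨f, hf⟩ := rv_update_poly R c i
  have hf0 : f ≠ 0 := by
    rintro rfl
    have := hf (c i)
    rw [Function.update_eq_self] at this
    simp at this
    exact hc this.symm
  have hfin := Z_finite hR hd c hc i
  let Z := hfin.toFinset
  have hZ : ∀ α ∈ Z, (∀ j, j ≠ i → ev (c j) α = 0) ∧ ev (c i) α = 1 := by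
    intro α hα
    simpa [Z] using hα
  have hZ0 : ∀ α ∈ Z, α ≠ 0 := by
    rintro α hα rfl
    have := (hZ 0 hα).2
    rw [ev_zero_right (hd i)] at this
    exact zero_ne_one this
  have hv : ∀ P, eval P f = 0 → ∃ α ∈ Z, ev P α = 0 := by
    intro P hP
    rw [hf] at hP
    by_contra! hcon
    refine rv_ne_zero hR (Function.update c i P) ?_ hP
    intro x hx
    by_contra hx0
    have hx1 : ∀ j, j ≠ i → ev (c j) x = 0 := by
      intro j hj
      simpa [hj] using hx j
    have hx2 : ev P x = 0 := by simpa using hx i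
    have hx3 : ev (c i) x ≠ 0 := by
      intro h
      apply hc
      apply rv_zero hR c x hx0
      intro j
      by_cases hj : j = i
      · subst hj; exact h
      · exact hx1 j hj
    obtain ⟨z, hz⟩ := IsAlgClosed.exists_pow_nat_eq (ev (c i) x)⁻¹ (n := d i) (hd i)
    refine hcon (z • x) ?_ ?_
    · simp only [Z, Set.Finite.mem_toFinset, Set.mem_setOf_eq]
      refine ⟨fun j hj => by rw [ev_smul_right, hx1 j hj, mul_zero], ?_⟩
      rw [ev_smul_right, hz, inv_mul_cancel₀ hx3]
    · rw [ev_smul_right, hx2, mul_zero]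
  have hrad : (∏ α ∈ Z, lf α) ∈ (Ideal.span {f}).radical := by
    rw [← vanishingIdeal_zeroLocus_eq_radical (K := ℂ), mem_vanishingIdeal_iff]
    intro P hP
    rw [mem_zeroLocus_iff] at hP
    have := hP f (Ideal.mem_span_singleton_self f)
    change eval P f = 0 at this
    change eval P _ = 0
    obtain ⟨α, hα, h0⟩ := hv P this
    rw [map_prod]
    exact Finset.prod_eq_zero hα (by rw [eval_lf, h0])
  obtain ⟨n, hn⟩ := hrad
  rw [Ideal.mem_span_singleton] at hn
  obtain ⟨g, hg⟩ := hn
  have hprod : f * g = 1 * ∏ p ∈ Z ×ˢ Finset.range n, lf p.1 := by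
    rw [← hg, one_mul, Finset.prod_product]
    simp [Finset.prod_pow]
  obtain ⟨s, u, b, b', hsu, -, hbb, hfs, -⟩ := mul_eq_mul_prime_prod (fun p hp =>
    lf_prime p.1 (hZ0 p.1 (Finset.mem_product.1 hp).1)) hprod
  have hbu : IsUnit b := IsUnit.of_mul_eq_one _ hbb.symm
  obtain ⟨a, ha, rfl⟩ := isUnit_iff_eq_C_of_isReduced.1 hbu
  have hsZ : ∀ p ∈ s, p.1 ∈ Z := by
    intro p hp
    have : p ∈ Z ×ˢ Finset.range n := by rw [← hsu]; exact Finset.mem_union_left _ hp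
    exact (Finset.mem_product.1 this).1
  have hfe : ∀ P, rv R (Function.update c i P) = a * ∏ p ∈ s, ev P p.1 := by
    intro P
    rw [← hf, hfs]
    simp [eval_lf]
  have hcard : s.card = e := by
    have h1 := hfe ((2:ℂ) • c i)
    have h2 := hfe (c i)
    rw [rv_update_smul he] at h1
    simp only [ev_smul, Finset.prod_mul_distrib, Finset.prod_const] at h1
    rw [← mul_left_comm, ← h2, Function.update_eq_self] at h1
    have h3 := mul_right_cancel₀ hc h1
    have h4 : (2:ℕ) ^ e = 2 ^ s.card := by exact_mod_cast h3
    exact (Nat.pow_right_injective le_rfl h4).symm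
  let E := s.equivFinOfCardEq hcard
  refine ⟨a, fun l => (E.symm l).1.1, fun l => hZ0 _ (hsZ _ (E.symm l).2),
    fun l => (hZ _ (hsZ _ (E.symm l).2)).1, fun P => ?_⟩
  rw [hfe]
  congr 1
  rw [← Finset.prod_coe_sort]
  exact (Equiv.prod_comp E.symm (fun p => ev P p.1.1)).symm

end
end BM


namespace BM
open MvPolynomial

lemma max_mod (q : ℂ → ℂ) (hq : Differentiable ℂ q) : ∃ w : ℂ, ‖w‖ = 1 ∧ ∀ z : ℂ, ‖z‖ ≤ 1 → ‖q z‖ ≤ ‖q w‖ := by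
  obtain ⟨w, hw, hmax⟩ := Complex.exists_mem_frontier_isMaxOn_norm (f := q)
    (Metric.isBounded_ball (x := (0:ℂ)) (r := 1)) ⟨0, by simp⟩ hq.diffContOnCl
  rw [frontier_ball _ one_ne_zero] at hw
  refine ⟨w, by simpa using hw, fun z hz => ?_⟩
  apply hmax
  rw [closure_ball _ one_ne_zero]
  simpa using hz

lemma lin1 {ι : Type*} (s : Finset ι) (p : ι → Prop) (a b : ι → ℂ) :
    ∃ z : ℂ, ‖z‖ ≤ 1 ∧
      (open Classical in ∏ k ∈ s, (if p k then ‖a k‖ else ‖b k‖)) ≤ ∏ k ∈ s, ‖a k + z * b k‖ := by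
  classical
  obtain ⟨w, hw, hmax⟩ := max_mod (fun z => ∏ k ∈ s,
    (if p k then (starRingEnd ℂ (b k)) * z + starRingEnd ℂ (a k) else a k * z + b k)) (by
      intro z
      apply DifferentiableAt.fun_finset_prod
      intro k _
      split_ifs <;> fun_prop)
  refine ⟨starRingEnd ℂ w, by simp [hw], ?_⟩
  have h := hmax 0 (by simp)
  rw [norm_prod, norm_prod] at h
  convert h using 1
  · refine Finset.prod_congr rfl fun k _ => ?_
    split_ifs <;> simp
  · refine Finset.prod_congr rfl fun k _ => ?_
    have hww : w * starRingEnd ℂ w = 1 := by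
      rw [Complex.mul_conj, Complex.normSq_eq_norm_sq, hw]; simp
    split_ifs
    · rw [← Complex.norm_conj]
      congr 1
      simp; ring
    · have : a k * w + b k = w * (a k + starRingEnd ℂ w * b k) := by
        linear_combination (- b k) * hww
      rw [this, norm_mul, hw, one_mul]

lemma lin {ι : Type*} (n : ℕ) : ∀ (s : Finset ι) (α : ι → Fin n → ℂ),
    ∃ L : Fin n → ℂ, (∀ j, ‖L j‖ ≤ 1) ∧ ∏ k ∈ s, ‖α k‖ ≤ ∏ k ∈ s, ‖∑ j, L j * α k j‖ := by
  classical
  induction n with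
  | zero =>
    intro s α
    refine ⟨0, by simp, ?_⟩
    apply Finset.prod_le_prod
    · intros; positivity
    · intro k _
      rw [Subsingleton.elim (α k) 0]; simp
  | succ n ih =>
    intro s α
    obtain ⟨L, hL, hle⟩ := ih (s.filter fun k => ¬ (‖Fin.tail (α k)‖ ≤ ‖α k 0‖))
      (fun k => Fin.tail (α k))
    obtain ⟨z, hz, hle2⟩ := lin1 s (fun k => ‖Fin.tail (α k)‖ ≤ ‖α k 0‖) (fun k => α k 0)
      (fun k => ∑ j, L j * Fin.tail (α k) j)
    refine ⟨Fin.cons 1 (fun j => z * L j), ?_, ?_⟩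
    · intro j
      refine Fin.cases (by simp) (fun j => ?_) j
      simp only [Fin.cons_succ, norm_mul]
      exact mul_le_one₀ hz (norm_nonneg _) (hL j)
    · have h1 : ∏ k ∈ s, ‖∑ j, (Fin.cons 1 (fun j => z * L j) : Fin (n+1) → ℂ) j * α k j‖ =
        ∏ k ∈ s, ‖α k 0 + z * ∑ j, L j * Fin.tail (α k) j‖ := by
        refine Finset.prod_congr rfl fun k _ => ?_
        rw [Fin.sum_univ_succ, Finset.mul_sum]
        simp [Fin.tail, mul_assoc]
      rw [h1]
      refine le_trans ?_ hle2
      have h2 : ∏ k ∈ s, ‖α k‖ ≤ ∏ k ∈ s, if ‖Fin.tail (α k)‖ ≤ ‖α k 0‖ then ‖α k 0‖ else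
          ‖Fin.tail (α k)‖ := by
        apply Finset.prod_le_prod
        · intros; positivity
        · intro k _
          rw [pi_norm_le_iff_of_nonneg (by split_ifs <;> positivity)]
          intro j
          refine Fin.cases ?_ (fun j => ?_) j
          · split_ifs with h
            · exact le_rfl
            · exact (not_le.1 h).le
          · have := norm_le_pi_norm (Fin.tail (α k)) j
            split_ifs with h
            · exact this.trans h
            · exact this
      refine h2.trans ?_
      rw [Finset.prod_ite, Finset.prod_ite]
      exact mul_le_mul_of_nonneg_left hle (Finset.prod_nonneg fun _ _ => norm_nonneg _)

section
variable {t : ℕ} {d : Fin (t+1) → ℕ}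

noncomputable def powF (L : Fin (t+1) → ℂ) (n : ℕ) : Mon t n → ℂ :=
  fun m => coeff m.1 ((∑ j, C (L j) * X j) ^ n)

lemma powF_hom (L : Fin (t+1) → ℂ) (n : ℕ) : ((∑ j, C (L j) * X j) ^ n :
    MvPolynomial (Fin (t+1)) ℂ).IsHomogeneous n := by
  have : (∑ j, C (L j) * X j : MvPolynomial (Fin (t+1)) ℂ).IsHomogeneous 1 := by
    apply IsHomogeneous.sum
    intro j _
    simpa using (isHomogeneous_C (Fin (t+1)) (L j)).mul (isHomogeneous_X ℂ j)
  simpa using this.pow n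

lemma ev_powF (L : Fin (t+1) → ℂ) (n : ℕ) (x : Fin (t+1) → ℂ) :
    ev (powF L n) x = (∑ j, L j * x j) ^ n := by
  have := sum_coeff_mpow _ (powF_hom L n) x
  unfold ev powF
  rw [this]
  simp

lemma powF_single (j : Fin (t+1)) (n : ℕ) : powF (Pi.single j 1) n = Pi.single (pw j n) 1 := by
  classical
  have h : (∑ k, C ((Pi.single j 1 : Fin (t+1) → ℂ) k) * X k : MvPolynomial (Fin (t+1)) ℂ) = X j := by
    rw [Finset.sum_eq_single j]
    · simp
    · intro b _ hb
      simp [Pi.single_eq_of_ne hb]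
    · simp
  funext m
  unfold powF
  rw [h, X_pow_eq_monomial, coeff_monomial, Pi.single_apply]
  by_cases hm : m = pw j n
  · subst hm; rw [if_pos rfl]; exact if_pos rfl
  · rw [if_neg hm, if_neg]
    intro h; exact hm (Subtype.ext h.symm)

lemma norm_mpow_le {n : ℕ} (x : Fin (t+1) → ℂ) (m : Mon t n) : ‖mpow x m.1‖ ≤ ‖x‖ ^ n := by
  have := m.2
  rw [Finsupp.degree_eq_sum] at this
  have h2 : ‖x‖ ^ n = ∏ j, ‖x‖ ^ (m.1 j) := by
    rw [Finset.prod_pow_eq_pow_sum, this]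
  rw [mpow, norm_prod, h2]
  apply Finset.prod_le_prod
  · intros; positivity
  · intro j _
    rw [norm_pow]
    gcongr
    exact norm_le_pi_norm x j

lemma norm_ev_le {n : ℕ} (c : Mon t n → ℂ) (x : Fin (t+1) → ℂ) :
    ‖ev c x‖ ≤ (Fintype.card (Mon t n) * ‖c‖) * ‖x‖ ^ n := by
  unfold ev
  refine (norm_sum_le _ _).trans ?_
  have : ∀ m ∈ (Finset.univ : Finset (Mon t n)), ‖c m * mpow x m.1‖ ≤ ‖c‖ * ‖x‖ ^ n := by
    intro m _
    rw [norm_mul]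
    exact mul_le_mul (norm_le_pi_norm c m) (norm_mpow_le x m) (norm_nonneg _) (norm_nonneg _)
  refine (Finset.sum_le_card_nsmul _ _ _ this).trans ?_
  rw [nsmul_eq_mul, Finset.card_univ, mul_assoc]

lemma phase1_step {R : MvPolynomial (U t d) ℤ} (hR : IsRes R) (hd : ∀ i, 1 ≤ d i)
    (e : Fin (t+1) → ℕ) (he : ∀ i, IsWeightedHomogeneous (wt d i) R (e i))
    (c : ∀ i, Mon t (d i) → ℂ) (i : Fin (t+1)) :
    ∃ l : Fin (t+1) → ℂ, ‖rv R c‖ ≤ (Fintype.card (Mon t (d i)) * ‖c i‖) ^ e i *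
      ‖rv R (Function.update c i (powF l (d i)))‖ ∧ ∀ j, ‖l j‖ ≤ 1 := by
  by_cases hc : rv R c = 0
  · refine ⟨0, ?_, by simp⟩
    rw [hc, norm_zero]; positivity
  obtain ⟨a, α, h0, h1, h2⟩ := fact hR hd c hc i (e i) (he i)
  obtain ⟨L, hL, hle⟩ := lin (t+1) Finset.univ α
  refine ⟨L, ?_, hL⟩
  have h3 := h2 (c i)
  rw [Function.update_eq_self] at h3
  rw [h3, h2, norm_mul, norm_mul, norm_prod, norm_prod]
  have h4 : ∏ l, ‖ev (c i) (α l)‖ ≤ ∏ l : Fin (e i), ((Fintype.card (Mon t (d i)) * ‖c i‖) * ‖α l‖ ^ d i) := by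
    apply Finset.prod_le_prod
    · intros; positivity
    · intro l _; exact norm_ev_le _ _
  rw [Finset.prod_mul_distrib, Finset.prod_const, Finset.card_univ, Fintype.card_fin,
    Finset.prod_pow] at h4
  have h5 : (∏ l, ‖α l‖) ^ d i ≤ ∏ l, ‖ev (powF L (d i)) (α l)‖ := by
    simp only [ev_powF, norm_pow]
    rw [Finset.prod_pow]
    gcongr
  calc ‖a‖ * ∏ l, ‖ev (c i) (α l)‖ ≤ ‖a‖ * ((Fintype.card (Mon t (d i)) * ‖c i‖) ^ e i *
        (∏ l, ‖ev (powF L (d i)) (α l)‖)) := by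
        gcongr
        refine h4.trans ?_
        gcongr
    _ = _ := by ring

lemma phase1 {R : MvPolynomial (U t d) ℤ} (hR : IsRes R) (hd : ∀ i, 1 ≤ d i)
    (e : Fin (t+1) → ℕ) (he : ∀ i, IsWeightedHomogeneous (wt d i) R (e i))
    (c : ∀ i, Mon t (d i) → ℂ) :
    ∃ L : Fin (t+1) → Fin (t+1) → ℂ, ‖rv R c‖ ≤
      (∏ i, (Fintype.card (Mon t (d i)) * ‖c i‖) ^ e i) *
      ‖rv R (fun i => powF (L i) (d i))‖ ∧ ∀ i j, ‖L i j‖ ≤ 1 := by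
  classical
  have key : ∀ s : Finset (Fin (t+1)), ∃ L : Fin (t+1) → Fin (t+1) → ℂ, ‖rv R c‖ ≤
      (∏ i ∈ s, (Fintype.card (Mon t (d i)) * ‖c i‖) ^ e i) *
      ‖rv R (fun i => if i ∈ s then powF (L i) (d i) else c i)‖ ∧ ∀ i j, ‖L i j‖ ≤ 1 := by
    intro s
    induction s using Finset.induction_on with
    | empty => exact ⟨0, by simp, by simp⟩
    | insert k s hk ih =>
      obtain ⟨L, h1, h2⟩ := ih
      obtain ⟨l, h3, h4⟩ := phase1_step hR hd e he
        (fun i => if i ∈ s then powF (L i) (d i) else c i) k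
      refine ⟨Function.update L k l, ?_, ?_⟩
      · have h5 : (Function.update (fun i => if i ∈ s then powF (L i) (d i) else c i) k (powF l (d k)))
          = (fun i => if i ∈ insert k s then powF (Function.update L k l i) (d i) else c i) := by
          funext i
          by_cases h : i = k
          · subst h; simp
          · simp [h]
        rw [h5] at h3
        simp only [if_neg hk] at h3
        rw [Finset.prod_insert hk]
        refine h1.trans ?_
        calc _ ≤ (∏ i ∈ s, (Fintype.card (Mon t (d i)) * ‖c i‖) ^ e i) * _ :=
              mul_le_mul_of_nonneg_left h3 (by positivity)
          _ = _ := by ring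
      · intro i
        by_cases h : i = k
        · subst h; simpa using h4
        · simpa [h] using h2 i
  simpa using key Finset.univ

lemma phase2_step {R : MvPolynomial (U t d) ℤ} (hR : IsRes R) (hd : ∀ i, 1 ≤ d i)
    (e : Fin (t+1) → ℕ) (he : ∀ i, IsWeightedHomogeneous (wt d i) R (e i))
    (L : Fin (t+1) → Fin (t+1) → ℂ) (i : Fin (t+1)) (hL : ∀ j, ‖L i j‖ ≤ 1) :
    ∃ k : Fin (t+1), ‖rv R (fun i => powF (L i) (d i))‖ ≤ ((t:ℝ)+1) ^ (d i * e i) *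
      ‖rv R (fun j => powF (Function.update L i (Pi.single k 1) j) (d j))‖ := by
  classical
  by_cases hc : rv R (fun i => powF (L i) (d i)) = 0
  · refine ⟨0, ?_⟩
    rw [hc, norm_zero]; positivity
  obtain ⟨a, α, h0, h1, h2⟩ := fact hR hd _ hc i (e i) (he i)
  have hup : ∀ l, (fun j => powF (Function.update L i l j) (d j)) =
      Function.update (fun i => powF (L i) (d i)) i (powF l (d i)) := by
    intro l
    funext j
    by_cases h : j = i
    · subst h; simp
    · simp [h]
  have hz : ∀ x : Fin (t+1) → ℂ, (∀ j, ∑ k, L j k * x k = 0) → x = 0 := by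
    intro x hx
    by_contra hx0
    refine hc (rv_zero hR _ x hx0 fun j => ?_)
    rw [ev_powF, hx, zero_pow (by have := hd j; omega)]
  have h1' : ∀ l j, j ≠ i → ∑ k, L j k * α l k = 0 := by
    intro l j hj
    have := h1 l j hj
    rw [ev_powF] at this
    exact pow_eq_zero_iff (by have := hd j; omega) |>.1 this
  have hk : ∃ k, ∀ l, ‖α l‖ ≤ ‖α l k‖ := by
    rcases Nat.eq_zero_or_pos (e i) with h | h
    · exact ⟨0, fun l => absurd l.2 (by omega)⟩
    let l0 : Fin (e i) := ⟨0, h⟩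
    have hne : ∑ k, L i k * α l0 k ≠ 0 := by
      intro h'
      refine h0 l0 (hz _ fun j => ?_)
      by_cases hj : j = i
      · subst hj; exact h'
      · exact h1' l0 j hj
    have hprop : ∀ l, ∃ μ : ℂ, α l = μ • α l0 := by
      intro l
      refine ⟨(∑ k, L i k * α l k) / (∑ k, L i k * α l0 k), ?_⟩
      rw [← sub_eq_zero]
      apply hz
      intro j
      have h5 : ∀ μ : ℂ, ∑ k, L j k * (α l - μ • α l0) k =
          ∑ k, L j k * α l k - μ * ∑ k, L j k * α l0 k := by
        intro μ
        rw [Finset.mul_sum, ← Finset.sum_sub_distrib]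
        refine Finset.sum_congr rfl fun k _ => ?_
        simp; ring
      rw [h5]
      by_cases hj : j = i
      · subst hj; field_simp; simp
      · rw [h1' l j hj, h1' l0 j hj]; simp
    obtain ⟨k, -, hk⟩ := Finset.exists_max_image Finset.univ (fun k => ‖α l0 k‖) ⟨0, Finset.mem_univ _⟩
    refine ⟨k, fun l => ?_⟩
    obtain ⟨μ, hμ⟩ := hprop l
    rw [hμ, norm_smul, Pi.smul_apply, norm_smul]
    gcongr
    rw [pi_norm_le_iff_of_nonneg (norm_nonneg _)]
    exact fun j => hk j (Finset.mem_univ j)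
  obtain ⟨k, hk⟩ := hk
  refine ⟨k, ?_⟩
  rw [hup, h2]
  have h3 := h2 (powF (L i) (d i))
  rw [Function.update_eq_self] at h3
  rw [h3, norm_mul, norm_mul, norm_prod, norm_prod]
  have h4 : ∏ l, ‖ev (powF (L i) (d i)) (α l)‖ ≤ ∏ l : Fin (e i),
      (((t:ℝ)+1) ^ d i * ‖ev (powF (Pi.single k 1) (d i)) (α l)‖) := by
    apply Finset.prod_le_prod
    · intros; positivity
    · intro l _
      rw [ev_powF, ev_powF, norm_pow, norm_pow, ← mul_pow]
      gcongr
      have h6 : ∑ j, (Pi.single k 1 : Fin (t+1) → ℂ) j * α l j = α l k := by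
        simp [Pi.single_apply]
      rw [h6]
      refine (norm_sum_le _ _).trans ?_
      have : ∀ j ∈ (Finset.univ : Finset (Fin (t+1))), ‖L i j * α l j‖ ≤ ‖α l k‖ := by
        intro j _
        rw [norm_mul]
        calc _ ≤ 1 * ‖α l‖ := by
              gcongr
              · exact hL j
              · exact norm_le_pi_norm _ _
          _ ≤ _ := by rw [one_mul]; exact hk l
      refine (Finset.sum_le_card_nsmul _ _ _ this).trans ?_
      simp
  rw [Finset.prod_mul_distrib, Finset.prod_const, Finset.card_univ, Fintype.card_fin,
    ← pow_mul] at h4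
  calc _ ≤ ‖a‖ * _ := mul_le_mul_of_nonneg_left h4 (norm_nonneg _)
    _ = _ := by ring

lemma phase2 {R : MvPolynomial (U t d) ℤ} (hR : IsRes R) (hd : ∀ i, 1 ≤ d i)
    (e : Fin (t+1) → ℕ) (he : ∀ i, IsWeightedHomogeneous (wt d i) R (e i))
    (L : Fin (t+1) → Fin (t+1) → ℂ) (hL : ∀ i j, ‖L i j‖ ≤ 1) :
    ‖rv R (fun i => powF (L i) (d i))‖ ≤ ((t:ℝ)+1) ^ (∑ i, d i * e i) := by
  classical
  have key : ∀ s : Finset (Fin (t+1)), ∃ κ : Fin (t+1) → Fin (t+1),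
      ‖rv R (fun i => powF (L i) (d i))‖ ≤ ((t:ℝ)+1) ^ (∑ i ∈ s, d i * e i) *
      ‖rv R (fun i => powF (if i ∈ s then Pi.single (κ i) 1 else L i) (d i))‖ := by
    intro s
    induction s using Finset.induction_on with
    | empty => exact ⟨id, by simp⟩
    | insert k s hk ih =>
      obtain ⟨κ, h1⟩ := ih
      obtain ⟨l, h3⟩ := phase2_step hR hd e he
        (fun i => if i ∈ s then Pi.single (κ i) 1 else L i) k (by
          simp only [if_neg hk]; exact hL k)
      refine ⟨Function.update κ k l, ?_⟩
      have h5 : ∀ i, (Function.update (fun i => if i ∈ s then (Pi.single (κ i) 1 : Fin (t+1) → ℂ)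
          else L i) k (Pi.single l 1)) i
          = if i ∈ insert k s then Pi.single (Function.update κ k l i) 1 else L i := by
        intro i
        by_cases h : i = k
        · subst h; simp
        · simp [h]
      simp only [h5] at h3
      rw [Finset.sum_insert hk, pow_add]
      refine h1.trans ?_
      calc _ ≤ ((t:ℝ)+1) ^ (∑ i ∈ s, d i * e i) * _ :=
            mul_le_mul_of_nonneg_left h3 (by positivity)
        _ = _ := by ring
  obtain ⟨κ, hκ⟩ := key Finset.univ
  simp only [Finset.mem_univ, if_true, powF_single] at hκ
  refine hκ.trans ?_
  have : ‖rv R (fun i => (Pi.single (pw (κ i) (d i)) 1 : Mon t (d i) → ℂ))‖ ≤ 1 := by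
    by_cases hinj : Function.Injective κ
    · have := res_perm hR hd (Equiv.ofBijective κ (Finite.injective_iff_bijective.1 hinj))
      exact this.le
    · have hs : ¬ Function.Surjective κ := fun h => hinj (Finite.injective_iff_surjective.2 h)
      unfold Function.Surjective at hs
      push Not at hs
      obtain ⟨k, hk⟩ := hs
      rw [rv_zero hR _ (Pi.single k 1)]
      · simp
      · intro h
        have := congrFun h k
        simp at this
      · intro i
        rw [ev_single, Pi.single_eq_of_ne (hk i), zero_pow (by have := hd i; omega), mul_zero]
  calc _ ≤ ((t:ℝ)+1) ^ (∑ i, d i * e i) * 1 := by gcongr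
    _ = _ := mul_one _

theorem rv_bound {R : MvPolynomial (U t d) ℤ} (hR : IsRes R) (hd : ∀ i, 1 ≤ d i)
    (e : Fin (t+1) → ℕ) (he : ∀ i, IsWeightedHomogeneous (wt d i) R (e i))
    (c : ∀ i, Mon t (d i) → ℂ) :
    ‖rv R c‖ ≤ (∏ i, (Fintype.card (Mon t (d i)) * ‖c i‖) ^ e i) *
      ((t:ℝ)+1) ^ (∑ i, d i * e i) := by
  obtain ⟨L, h1, h2⟩ := phase1 hR hd e he c
  refine h1.trans ?_
  gcongr
  exact phase2 hR hd e he L h2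

end
end BM


namespace BM
open MvPolynomial

lemma schwarz (p : Polynomial ℂ) (ε M : ℝ) (h0 : 0 < ε) (hp : p.eval (ε:ℂ) = 0)
    (hM : ∀ z : ℂ, ‖z‖ ≤ 1 → ‖p.eval z‖ ≤ M) : ‖p.eval 0‖ ≤ ε * M := by
  obtain ⟨q, hq⟩ := Polynomial.dvd_iff_isRoot.2 hp
  obtain ⟨w, hw, hmax⟩ := max_mod (fun s => (1 - ε * s) * q.eval s) (by
    have := q.differentiable
    fun_prop)
  have h1 := hmax 0 (by simp)
  have h2 := hM w hw.le
  rw [hq] at h2 ⊢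
  simp only [Polynomial.eval_mul, Polynomial.eval_sub, Polynomial.eval_X, Polynomial.eval_C,
    norm_mul] at h1 h2 ⊢
  have h3 : ‖1 - (ε:ℂ) * w‖ = ‖w - ε‖ := by
    have hww : w * starRingEnd ℂ w = 1 := by
      rw [Complex.mul_conj, Complex.normSq_eq_norm_sq, hw]; simp
    have : 1 - (ε:ℂ) * w = w * starRingEnd ℂ (w - ε) := by
      simp only [map_sub, Complex.conj_ofReal]
      linear_combination -hww
    rw [this, norm_mul, hw, one_mul, Complex.norm_conj]
  rw [h3] at h1
  simp at h1
  have h4 : ‖(0:ℂ) - ε‖ = ε := by simp [abs_of_pos h0]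
  rw [h4]
  gcongr
  exact h1.trans h2

section
variable {t : ℕ} {d : Fin (t+1) → ℕ}

lemma norm_single_one {n : ℕ} (j : Fin (t+1)) :
    ‖(Pi.single (pw j n) 1 : Mon t n → ℂ)‖ ≤ 1 := by
  rw [pi_norm_le_iff_of_nonneg zero_le_one]
  intro m
  by_cases h : m = pw j n
  · subst h; simp
  · simp [Pi.single_eq_of_ne h]

theorem schwarz_rv {R : MvPolynomial (U t d) ℤ} (hR : IsRes R) (hd : ∀ i, 1 ≤ d i)
    (e : Fin (t+1) → ℕ) (he : ∀ i, IsWeightedHomogeneous (wt d i) R (e i))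
    (c : ∀ i, Mon t (d i) → ℂ) (x : Fin (t+1) → ℂ) (hx : x 0 = 1) (ε : ℝ) (h0 : 0 < ε)
    (b : Fin (t+1) → ℝ) (hb : ∀ i, ‖c i‖ ≤ b i) (hbx : ∀ i, ‖ev (c i) x‖ ≤ ε * b i) :
    ‖rv R c‖ ≤ ε * ((∏ i, (Fintype.card (Mon t (d i)) * (2 * b i)) ^ e i) *
      ((t:ℝ)+1) ^ (∑ i, d i * e i)) := by
  let p : Polynomial ℂ := rv R (fun i => (fun m => Polynomial.C (c i m)) -
    (Polynomial.X * Polynomial.C (ev (c i) x / ε)) • Pi.single (pw 0 (d i)) 1)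
  have hp : ∀ s : ℂ, p.eval s = rv R (fun i => c i -
      (s * (ev (c i) x / ε)) • Pi.single (pw 0 (d i)) 1) := by
    intro s
    have := rv_map (Polynomial.evalRingHom s) R (fun i => (fun m => Polynomial.C (c i m)) -
      (Polynomial.X * Polynomial.C (ev (c i) x / ε)) • Pi.single (pw 0 (d i)) 1)
    refine this.trans ?_
    congr 1
    funext i m
    by_cases h : m = pw 0 (d i)
    · subst h; simp; ring
    · simp [Pi.single_eq_of_ne h]
  have h1 := schwarz p ε ((∏ i, (Fintype.card (Mon t (d i)) * (2 * b i)) ^ e i) *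
      ((t:ℝ)+1) ^ (∑ i, d i * e i)) h0 ?_ ?_
  · rw [hp] at h1
    simpa using h1
  · rw [hp]
    apply rv_zero hR _ x
    · intro h; rw [h] at hx; simp at hx
    · intro i
      rw [ev_sub, ev_smul, ev_single, hx]
      have : (ε:ℂ) ≠ 0 := by exact_mod_cast h0.ne'
      field_simp
      simp
  · intro z hz
    rw [hp]
    refine (rv_bound hR hd e he _).trans ?_
    gcongr with i
    have h5 : ‖ev (c i) x / ε‖ ≤ b i := by
      rw [norm_div, Complex.norm_real, Real.norm_of_nonneg h0.le, div_le_iff₀ h0, mul_comm]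
      exact hbx i
    calc _ ≤ ‖c i‖ + ‖(z * (ev (c i) x / ε)) • (Pi.single (pw 0 (d i)) 1 : Mon t (d i) → ℂ)‖ :=
          norm_sub_le _ _
      _ ≤ b i + 1 * b i * 1 := by
        rw [norm_smul, norm_mul]
        have hb0 : 0 ≤ b i := (norm_nonneg _).trans (hb i)
        gcongr
        · exact hb i
        · exact norm_single_one _
      _ = _ := by ring

end
end BM


namespace BM
open MvPolynomial

lemma choice_aux {t : ℕ} {ι : Type*} [Fintype ι] (P : MvPolynomial (Fin (t+1)) ℂ) (hP : P ≠ 0)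
    (F : ι → MvPolynomial (Fin (t+1)) ℂ) (n : ℕ) :
    ∃ a : Fin n → ι → ℂ, ∀ 𝔭 : Ideal (MvPolynomial (Fin (t+1)) ℂ), 𝔭.IsPrime → P ∈ 𝔭 →
      (∀ i, Fintype.linearCombination ℂ F (a i) ∈ 𝔭) → (∃ k, F k ∉ 𝔭) →
        ((n + 1 : ℕ) : ℕ∞) ≤ 𝔭.height := by
  classical
  induction n with
  | zero =>
    refine ⟨fun _ _ => 0, fun 𝔭 h1 h2 _ _ => ?_⟩
    simp only [zero_add, Nat.cast_one]
    rw [Order.one_le_iff_ne_zero, Ne, Ideal.height_eq_zero_iff_eq_bot]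
    rintro rfl
    exact hP (by simpa using h2)
  | succ n ih =>
    obtain ⟨a, ha⟩ := ih
    let I : Ideal (MvPolynomial (Fin (t+1)) ℂ) :=
      Ideal.span (insert P (Set.range fun i => Fintype.linearCombination ℂ F (a i)))
    have hI := Ideal.finite_minimalPrimes_of_isNoetherianRing _ I
    let V : Ideal (MvPolynomial (Fin (t+1)) ℂ) → Subspace ℂ (ι → ℂ) := fun 𝔮 =>
      (Submodule.restrictScalars ℂ 𝔮).comap (Fintype.linearCombination ℂ F)
    have hV : ∀ 𝔮 b, b ∈ V 𝔮 ↔ Fintype.linearCombination ℂ F b ∈ 𝔮 := by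
      intro 𝔮 b; simp [V]
    let s : Finset (Subspace ℂ (ι → ℂ)) :=
      (hI.toFinset.filter (fun 𝔮 => ∃ k, F k ∉ 𝔮)).image V
    have hs : ⊤ ∉ s := by
      intro h
      simp only [s, Finset.mem_image, Finset.mem_filter] at h
      obtain ⟨𝔮, ⟨_, k, hk⟩, h2⟩ := h
      apply hk
      have : (Pi.single k 1 : ι → ℂ) ∈ V 𝔮 := by rw [h2]; trivial
      rw [hV] at this
      simpa [Fintype.linearCombination_apply_single] using this
    have h3 := Subspace.biUnion_ne_univ_of_top_notMem hs
    rw [Set.ne_univ_iff_exists_notMem] at h3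
    obtain ⟨b, hb⟩ := h3
    refine ⟨Fin.snoc a b, fun 𝔭 h1 h2 h4 ⟨k, hk⟩ => ?_⟩
    have hIp : I ≤ 𝔭 := by
      rw [Ideal.span_le, Set.insert_subset_iff]
      refine ⟨h2, ?_⟩
      rintro _ ⟨i, rfl⟩
      have := h4 i.castSucc
      simpa using this
    obtain ⟨𝔮, hq, hqp⟩ := Ideal.exists_minimalPrimes_le hIp
    have hqk : F k ∉ 𝔮 := fun h => hk (hqp h)
    have hqpr : 𝔮.IsPrime := hq.1.1
    have hIq : I ≤ 𝔮 := hq.1.2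
    have hlt : 𝔮 < 𝔭 := by
      refine lt_of_le_of_ne hqp ?_
      rintro rfl
      apply hb
      simp only [Set.mem_iUnion]
      refine ⟨V 𝔮, ?_, ?_⟩
      · simp only [s, Finset.mem_image, Finset.mem_filter]
        exact ⟨𝔮, ⟨by simpa using hq, k, hqk⟩, rfl⟩
      · have := h4 (Fin.last n)
        rw [SetLike.mem_coe, hV]
        simpa using this
    have h5 := ha 𝔮 hqpr (hIq (Ideal.subset_span (Set.mem_insert _ _)))
      (fun i => hIq (Ideal.subset_span (Set.mem_insert_of_mem _ ⟨i, rfl⟩))) ⟨k, hqk⟩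
    have h6 := Ideal.height_add_one_le_of_lt_of_isPrime hlt
    refine le_trans ?_ h6
    push_cast at h5 ⊢
    gcongr

theorem choice_C {t : ℕ} {ι : Type*} [Fintype ι] {D S : ℕ} (p : Mon t D → ℂ) (hp : p ≠ 0)
    (hD : 1 ≤ D) (hS : 1 ≤ S)
    (f : ι → Mon t S → ℂ) (hf : ∀ z, (∀ k, ev (f k) z = 0) → z = 0) :
    ∃ a : Fin t → ι → ℂ, ∀ z, ev p z = 0 →
      (∀ i, ev (Fintype.linearCombination ℂ f (a i)) z = 0) → z = 0 := by
  have hP : pf p ≠ 0 := by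
    intro h
    apply hp
    funext m
    rw [← coeff_pf p m, h]; simp
  obtain ⟨a, ha⟩ := choice_aux (pf p) hP (fun k => pf (f k)) t
  refine ⟨a, fun z hz hza => ?_⟩
  by_contra hz0
  let φ : MvPolynomial (Fin (t+1)) ℂ →ₐ[ℂ] Polynomial ℂ :=
    aeval (fun j => Polynomial.C (z j) * Polynomial.X)
  have hφ : ∀ q s, (φ q).eval s = eval (s • z) q := by
    intro q s
    have : ((Polynomial.evalRingHom s).comp φ.toRingHom) = eval (s • z) := by
      apply MvPolynomial.ringHom_ext
      · intro r
        simp [φ]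
      · intro j
        have : φ (X j) = Polynomial.C (z j) * Polynomial.X := aeval_X _ _
        change (φ (X j)).eval s = _
        rw [this, eval_X, Polynomial.eval_mul, Polynomial.eval_C, Polynomial.eval_X]
        exact mul_comm _ _
    exact congrArg (fun g => g q) this
  have hmem : ∀ {n : ℕ} (c : Mon t n → ℂ), pf c ∈ RingHom.ker φ ↔ ev c z = 0 := by
    intro n c
    rw [RingHom.mem_ker]
    constructor
    · intro h
      have := hφ (pf c) 1
      rw [h, one_smul, eval_pf] at this
      simpa using this.symm
    · intro h
      apply Polynomial.funext
      intro s
      rw [hφ, eval_pf, ev_smul_right, h]; simp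
  have hlin : ∀ b, Fintype.linearCombination ℂ (fun k => pf (f k)) b =
      pf (Fintype.linearCombination ℂ f b) := by
    intro b
    simp only [Fintype.linearCombination_apply, pf, Finset.sum_apply, Pi.smul_apply, map_sum,
      Finset.smul_sum, smul_monomial]
    rw [Finset.sum_comm]
  have hpr : (RingHom.ker φ).IsPrime := RingHom.ker_isPrime _
  have h1 := ha (RingHom.ker φ) hpr ((hmem p).2 hz) (fun i => by
    rw [hlin]; exact (hmem _).2 (hza i)) (by
    by_contra! h
    exact hz0 (hf z fun k => (hmem _).1 (h k)))
  let ψ : MvPolynomial (Fin (t+1)) ℂ →+* ℂ := eval 0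
  have hpr2 : (RingHom.ker ψ).IsPrime := RingHom.ker_isPrime _
  have hlt : RingHom.ker φ < RingHom.ker ψ := by
    rw [SetLike.lt_iff_le_and_exists]
    constructor
    · intro q hq
      rw [RingHom.mem_ker] at hq ⊢
      have := hφ q 0
      rw [hq, zero_smul, Polynomial.eval_zero] at this
      exact this.symm
    · obtain ⟨j, hj⟩ := Function.ne_iff.1 hz0
      refine ⟨X j, by simp [RingHom.mem_ker, ψ], ?_⟩
      rw [RingHom.mem_ker]
      simpa [φ] using hj
  have h6 := Ideal.height_add_one_le_of_lt_of_isPrime hlt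
  have h7 := Ideal.height_le_ringKrullDim_of_isPrime (I := RingHom.ker ψ)
  rw [MvPolynomial.ringKrullDim_of_isNoetherianRing, ringKrullDim_eq_zero_of_field] at h7
  have h8 : ((t + 1 : ℕ) : ℕ∞) + 1 ≤ (RingHom.ker ψ).height := le_trans (by gcongr) h6
  have h9 : ((((t + 1 : ℕ) : ℕ∞) + 1 : ℕ∞) : WithBot ℕ∞) ≤ 0 + ((Nat.card (Fin (t+1)) : ℕ) : WithBot ℕ∞) :=
    le_trans (by exact_mod_cast h8) h7
  simp at h9
  norm_cast at h9
  omega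

end BM


namespace BM
open MvPolynomial

lemma degreeOf_aeval' {σ τ : Type*} [Fintype σ] (w : σ → ℕ) (p : MvPolynomial σ ℤ) (e : ℕ)
    (hp : IsWeightedHomogeneous w p e) (G : σ → MvPolynomial τ ℂ) (k : τ)
    (hG : ∀ u, degreeOf k (G u) ≤ w u) : degreeOf k (aeval G p) ≤ e := by
  rw [aeval_def, eval₂_eq']
  refine (degreeOf_sum_le _ _ _).trans (Finset.sup_le fun m hm => ?_)
  have h := hp (mem_support_iff.1 hm)
  rw [Finsupp.weight_apply, Finsupp.sum_fintype _ _ (by simp)] at h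
  have h1 : algebraMap ℤ (MvPolynomial τ ℂ) (coeff m p) = C ((coeff m p : ℤ) : ℂ) := by
    simp
  rw [h1]
  refine (degreeOf_mul_le _ _ _).trans ?_
  rw [degreeOf_C, zero_add, ← h]
  refine (degreeOf_prod_le _ _ _).trans (Finset.sum_le_sum fun i _ => ?_)
  refine (degreeOf_pow_le _ _ _).trans ?_
  rw [smul_eq_mul]
  exact Nat.mul_le_mul le_rfl (hG i)

section
variable {t D S : ℕ}

def dd (t D S : ℕ) (i : Fin (t+1)) : ℕ := Fin.cases D (fun _ => S) i

def mk {A : Type*} (p : Mon t D → A) (q : Fin t → Mon t S → A) (i : Fin (t+1)) :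
    Mon t (dd t D S i) → A :=
  Fin.cases (motive := fun i => Mon t (dd t D S i) → A) p q i

lemma mk_map {A B : Type*} (φ : A → B) (p : Mon t D → A) (q : Fin t → Mon t S → A) :
    (fun i m => φ (mk p q i m)) = mk (fun m => φ (p m)) (fun i m => φ (q i m)) := by
  funext i
  refine Fin.cases ?_ (fun i => ?_) i <;> rfl

theorem choice_N {ι : Type} [Finite ι] {R : MvPolynomial (U t (dd t D S)) ℤ} (hR : IsRes R)
    (hD : 1 ≤ D) (hS : 1 ≤ S)
    (e : Fin (t+1) → ℕ) (he : ∀ i, IsWeightedHomogeneous (wt (dd t D S) i) R (e i)) (A : ℕ)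
    (hA : ∀ i : Fin t, e i.succ ≤ A)
    (p : Mon t D → ℂ) (hp : p ≠ 0)
    (f : ι → Mon t S → ℂ) (hf : ∀ z, (∀ k, ev (f k) z = 0) → z = 0) :
    ∃ (κ : Type) (_ : Fintype κ) (g : κ → ι) (a : Fin t → κ → ℕ),
      Fintype.card κ ≤ Fintype.card (Mon t S) ∧ (∀ i k, a i k ≤ A) ∧
      rv R (mk p (fun i m => ∑ k, (a i k : ℂ) * f (g k) m)) ≠ 0 := by
  classical
  obtain ⟨κ, g, hg, hspan, hli⟩ := exists_linearIndependent' ℂ f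
  have : Finite κ := Finite.of_injective g hg
  have : Fintype κ := Fintype.ofFinite κ
  have hcard : Fintype.card κ ≤ Fintype.card (Mon t S) := by
    simpa using hli.fintype_card_le_finrank
  have hf' : ∀ z, (∀ k, ev ((f ∘ g) k) z = 0) → z = 0 := by
    intro z hz
    refine hf z fun k => ?_
    let L : (Mon t S → ℂ) →ₗ[ℂ] ℂ :=
      { toFun := fun c => ev c z
        map_add' := fun c c' => ev_add c c' z
        map_smul' := fun a c => by simp [ev_smul] }
    have h1 : Submodule.span ℂ (Set.range (f ∘ g)) ≤ LinearMap.ker L := by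
      rw [Submodule.span_le]
      rintro _ ⟨k, rfl⟩
      exact hz k
    rw [hspan] at h1
    exact h1 (Submodule.subset_span ⟨k, rfl⟩)
  obtain ⟨b, hb⟩ := choice_C p hp hD hS (f ∘ g) hf'
  let Φ : MvPolynomial (Fin t × κ) ℂ :=
    rv R (mk (fun m => C (p m)) (fun i m => ∑ k, X (i, k) * C (f (g k) m)))
  have hΦ : ∀ x : Fin t × κ → ℂ, eval x Φ =
      rv R (mk p (fun i m => ∑ k, x (i, k) * f (g k) m)) := by
    intro x
    simp only [Φ]
    rw [rv_map, mk_map (fun y => eval x y)]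
    simp
  have hΦ0 : Φ ≠ 0 := by
    intro h0
    have h1 := hΦ (fun q => b q.1 q.2)
    rw [h0, map_zero] at h1
    refine rv_ne_zero hR _ ?_ h1.symm
    intro z hz
    refine hb z (hz 0) fun i => ?_
    have : ev (fun m : Mon t S => ∑ k, b i k * f (g k) m) z = 0 := hz i.succ
    convert this using 2
    funext m
    rw [Fintype.linearCombination_apply]
    simp only [Finset.sum_apply, Pi.smul_apply, smul_eq_mul, Function.comp]
  have h2 : ¬ ∀ x : Fin t × κ → ℂ,
      (∀ i, x i ∈ (Finset.range (A+1)).image (fun n : ℕ => (n : ℂ))) → eval x Φ = 0 := by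
    intro h
    refine hΦ0 (eq_zero_of_eval_zero_at_prod_finset Φ _ (fun q => ?_) h)
    rw [Finset.card_image_of_injective _ Nat.cast_injective, Finset.card_range, Nat.lt_succ_iff]
    refine le_trans ?_ (hA q.1)
    refine degreeOf_aeval' _ R _ (he q.1.succ) _ q ?_
    rintro ⟨j, m⟩
    revert m
    refine Fin.cases ?_ (fun j => ?_) j
    · intro m
      change degreeOf q (C (p m)) ≤ _
      simp
    · intro m
      change degreeOf q (∑ k, X (j, k) * C (f (g k) m)) ≤ _
      refine (degreeOf_sum_le _ _ _).trans (Finset.sup_le fun k _ => ?_)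
      refine (degreeOf_mul_le _ _ _).trans ?_
      rw [degreeOf_C, degreeOf_X]
      by_cases hj : j = q.1
      · subst hj
        simp only [wt, if_true]
        split_ifs <;> simp
      · rw [if_neg]
        · simp
        · rintro rfl; exact hj rfl
  push Not at h2
  obtain ⟨x, hx, hx2⟩ := h2
  simp only [Finset.mem_image, Finset.mem_range, Nat.lt_succ_iff] at hx
  choose a ha1 ha2 using hx
  refine ⟨κ, inferInstance, g, fun i k => a (i, k), hcard, fun i k => ha1 _, ?_⟩
  rw [hΦ] at hx2
  simpa only [ha2] using hx2

lemma card_Mon (t n : ℕ) : Fintype.card (Mon t n) ≤ (t+1)^n := by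
  classical
  let W : (Fin n → Fin (t+1)) → Mon t n := fun w =>
      (⟨∑ i, Finsupp.single (w i) 1, by simp [map_sum]⟩ : Mon t n)
  have h : Function.Surjective W := by
    rintro ⟨m, hm⟩
    have h1 : m.toMultiset.toList.length = n := by
      rw [Multiset.length_toList, Finsupp.card_toMultiset, ← hm]
      rfl
    refine ⟨fun i => m.toMultiset.toList.get (i.cast h1.symm), Subtype.ext ?_⟩
    subst h1
    have h2 : ∀ l : List (Fin (t+1)), ∑ i : Fin l.length, Finsupp.single (l.get i) 1 =
        Multiset.toFinsupp (l : Multiset (Fin (t+1))) := by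
      intro l
      induction l with
      | nil => simp
      | cons a l ih =>
        rw [← Multiset.cons_coe, ← Multiset.singleton_add, map_add, ← ih]
        simp only [List.length_cons]
        rw [Fin.sum_univ_succ]
        simp
    have := h2 m.toMultiset.toList
    rw [Multiset.coe_toList, Finsupp.toMultiset_toFinsupp] at this
    exact this
  have := Fintype.card_le_of_surjective _ h
  simpa using this

end
end BM


namespace BM
open MvPolynomial NumberField nonZeroDivisors

section
variable {K : Type*} [Field K] [NumberField K]

lemma prod_emb (x : K) : ∏ σ : K →+* ℂ, ‖σ x‖ = ((|Algebra.norm ℚ x| : ℚ) : ℝ) := by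
  have h := congr_arg (‖·‖) (Algebra.norm_eq_prod_embeddings ℚ ℂ x)
  simp only [norm_prod] at h
  rw [Fintype.prod_equiv (RingHom.equivRatAlgHom K ℂ) (fun σ : K →+* ℂ => ‖σ x‖)
    (fun σ : K →ₐ[ℚ] ℂ => ‖σ x‖) (fun σ => by simp [RingHom.equivRatAlgHom])]
  rw [← h]
  simp

lemma absNorm_le (I : FractionalIdeal (𝓞 K)⁰ K) (r : K) (hr : r ≠ 0) (hI : r ∈ I) :
    ((FractionalIdeal.absNorm I : ℚ) : ℝ) ≤ ∏ σ : K →+* ℂ, ‖σ r‖ := by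
  rw [prod_emb, ← FractionalIdeal.absNorm_span_singleton (𝓞 K) r]
  norm_cast
  have hI0 : I ≠ 0 := by
    rintro rfl
    exact hr (by simpa using hI)
  have hle : FractionalIdeal.spanSingleton (𝓞 K)⁰ r ≤ I := by
    rwa [FractionalIdeal.spanSingleton_le_iff_mem]
  have hJ : I⁻¹ * FractionalIdeal.spanSingleton (𝓞 K)⁰ r ≤ 1 := by
    calc _ ≤ I⁻¹ * I := by gcongr
      _ = 1 := inv_mul_cancel₀ hI0
  obtain ⟨J, hJ⟩ := FractionalIdeal.le_one_iff_exists_coeIdeal.1 hJ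
  have h1 : FractionalIdeal.spanSingleton (𝓞 K)⁰ r = I * (J : FractionalIdeal (𝓞 K)⁰ K) := by
    rw [hJ, ← mul_assoc, mul_inv_cancel₀ hI0, one_mul]
  have hJ0 : J ≠ ⊥ := by
    rintro rfl
    rw [FractionalIdeal.coeIdeal_bot, mul_zero, FractionalIdeal.spanSingleton_eq_zero_iff] at h1
    exact hr h1
  rw [h1, map_mul, FractionalIdeal.coeIdeal_absNorm]
  have h2 : (1:ℚ) ≤ Ideal.absNorm J := by
    have : Ideal.absNorm J ≠ 0 := by rwa [Ne, Ideal.absNorm_eq_zero_iff]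
    exact_mod_cast Nat.one_le_iff_ne_zero.2 this
  exact le_mul_of_one_le_right (FractionalIdeal.absNorm_nonneg I) h2

lemma pow_mem_frac (I : FractionalIdeal (𝓞 K)⁰ K) (y : K) (hy : y ∈ I) (n : ℕ) : y ^ n ∈ I ^ n := by
  induction n with
  | zero => simp
  | succ n ih => rw [pow_succ, pow_succ]; exact FractionalIdeal.mul_mem_mul ih hy

lemma prod_mem_frac {σ : Type*} (s : Finset σ) (I : σ → FractionalIdeal (𝓞 K)⁰ K) (y : σ → K)
    (hy : ∀ u ∈ s, y u ∈ I u) : ∏ u ∈ s, y u ∈ ∏ u ∈ s, I u := by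
  classical
  induction s using Finset.induction_on with
  | empty => simp
  | insert a s ha ih =>
    rw [Finset.prod_insert ha, Finset.prod_insert ha]
    exact FractionalIdeal.mul_mem_mul (hy a (by simp)) (ih fun u hu => hy u (by simp [hu]))

lemma aeval_mem_frac {σ : Type*} [Fintype σ] (w : σ → ℕ) (p : MvPolynomial σ ℤ) (e : ℕ)
    (hp : IsWeightedHomogeneous w p e) (I : FractionalIdeal (𝓞 K)⁰ K) (y : σ → K)
    (hy : ∀ u, y u ∈ I ^ w u) : aeval y p ∈ I ^ e := by
  rw [aeval_def, eval₂_eq']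
  refine Submodule.sum_mem (I ^ e : FractionalIdeal (𝓞 K)⁰ K).coeToSubmodule fun m hm => ?_
  have h := hp (mem_support_iff.1 hm)
  rw [Finsupp.weight_apply, Finsupp.sum_fintype _ _ (by simp)] at h
  have h1 : ∏ u, y u ^ m u ∈ I ^ e := by
    rw [← h, ← Finset.prod_pow_eq_pow_sum]
    refine prod_mem_frac _ _ _ fun u _ => ?_
    rw [smul_eq_mul, mul_comm, pow_mul]
    exact pow_mem_frac _ _ (hy u) _
  have h2 := Submodule.smul_mem (I ^ e : FractionalIdeal (𝓞 K)⁰ K).coeToSubmodule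
    ((coeff m p : ℤ) : 𝓞 K) h1
  rw [Algebra.smul_def] at h2
  simpa using h2

lemma one_le_prod_emb (r : K) (hr : r ≠ 0) (hi : IsIntegral ℤ r) :
    1 ≤ ∏ σ : K →+* ℂ, ‖σ r‖ := by
  have := absNorm_le (K := K) 1 r hr (by
    rw [FractionalIdeal.mem_one_iff]
    exact ⟨⟨r, hi⟩, rfl⟩)
  simpa using this

end
end BM


namespace BM
open MvPolynomial NumberField nonZeroDivisors

lemma num_bound {t D S : ℕ} (ht : 1 ≤ t) (hD : 1 ≤ D) (hDS : D ≤ S) (cD M A : ℕ)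
    (hcD : cD ≤ (t+1)^D) (hM : M ≤ (t+1)^S) (hA : A = D * S ^ (t-1)) (B : ℝ) (hB : 1 ≤ B)
    (e : Fin (t+1) → ℕ) (h0 : e 0 ≤ S ^ t) (h1 : ∀ i : Fin t, e i.succ ≤ A) :
    ((cD : ℝ) * 2) ^ e 0 * (∏ i : Fin t, ((M : ℝ) * (2 * (M * A * B))) ^ e i.succ) *
      ((t:ℝ)+1) ^ (∑ i, dd t D S i * e i) ≤
      (((t:ℝ)+1) ^ (8 * S) * (S:ℝ) ^ (2*t) * B) ^ (t * A) := by
  have hS : 1 ≤ S := hD.trans hDS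
  have hSA : D * S ^ t = S * A := by
    obtain ⟨k, rfl⟩ : ∃ k, t = k + 1 := ⟨t - 1, by omega⟩
    rw [hA]; simp only [Nat.add_sub_cancel]; ring
  have hAS : A ≤ S ^ t := by
    obtain ⟨k, rfl⟩ : ∃ k, t = k + 1 := ⟨t - 1, by omega⟩
    rw [hA]; simp only [Nat.add_sub_cancel]
    rw [pow_succ']; gcongr
  set q : ℝ := (t:ℝ)+1 with hq
  have hq2 : 2 ≤ q := by
    have : (1:ℝ) ≤ t := by exact_mod_cast ht
    linarith
  have hq1 : 1 ≤ q := by linarith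
  have hcD' : (cD:ℝ) ≤ q ^ D := by
    rw [hq]; exact_mod_cast hcD
  have hM' : (M:ℝ) ≤ q ^ S := by
    rw [hq]; exact_mod_cast hM
  have hA' : (A:ℝ) ≤ (S:ℝ)^t := by exact_mod_cast hAS
  have hS1 : (1:ℝ) ≤ S := by exact_mod_cast hS
  have hqD : q ≤ q ^ D := le_self_pow₀ hq1 (by omega)
  have hqS : q ≤ q ^ S := le_self_pow₀ hq1 (by omega)
  have a1 : ((cD : ℝ) * 2) ^ e 0 ≤ q ^ (2 * (S * A)) := by
    calc ((cD : ℝ) * 2) ^ e 0 ≤ (q ^ D * q ^ D) ^ e 0 := by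
          gcongr; linarith
      _ ≤ (q ^ D * q ^ D) ^ (S ^ t) := by
          apply pow_le_pow_right₀ _ h0
          have := one_le_pow₀ (n := D) hq1
          nlinarith
      _ = _ := by
          rw [← pow_add, ← pow_mul]; congr 1
          rw [← hSA]; ring
  have a2 : ∏ i : Fin t, ((M : ℝ) * (2 * (M * A * B))) ^ e i.succ ≤
      (q ^ (3 * S) * (S:ℝ)^t * B) ^ (t * A) := by
    have hb : 1 ≤ q ^ (3 * S) * (S:ℝ)^t * B := by
      have x1 := one_le_pow₀ (n := 3 * S) hq1
      have x2 := one_le_pow₀ (n := t) hS1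
      exact one_le_mul_of_one_le_of_one_le (one_le_mul_of_one_le_of_one_le x1 x2) hB
    calc _ ≤ ∏ i : Fin t, (q ^ (3 * S) * (S:ℝ)^t * B) ^ A := by
          refine Finset.prod_le_prod (fun i _ => by positivity) fun i _ => ?_
          calc _ ≤ (q ^ (3 * S) * (S:ℝ)^t * B) ^ e i.succ := by
                refine pow_le_pow_left₀ (by positivity) ?_ _
                calc (M : ℝ) * (2 * (M * A * B)) ≤ q ^ S * (q ^ S * (q ^ S * (S:ℝ)^t * B)) := by
                      gcongr
                      linarith
                  _ = _ := by ring
            _ ≤ _ := pow_le_pow_right₀ hb (h1 i)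
      _ = _ := by
          rw [Finset.prod_const, ← pow_mul]; simp [mul_comm]
  have a3 : q ^ (∑ i, dd t D S i * e i) ≤ q ^ (S * A + t * (S * A)) := by
    apply pow_le_pow_right₀ hq1
    rw [Fin.sum_univ_succ]
    apply Nat.add_le_add
    · rw [← hSA]; exact Nat.mul_le_mul le_rfl h0
    · calc _ ≤ ∑ i : Fin t, S * A := Finset.sum_le_sum fun i _ => Nat.mul_le_mul le_rfl (h1 i)
        _ = _ := by simp
  calc _ ≤ q ^ (2 * (S * A)) * (q ^ (3 * S) * (S:ℝ)^t * B) ^ (t * A) *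
        q ^ (S * A + t * (S * A)) := by
        gcongr
    _ = q ^ (2 * (S * A) + 3 * S * (t * A) + (S * A + t * (S * A))) *
        ((S:ℝ)^(t * (t * A)) * B ^ (t * A)) := by
        rw [mul_pow, mul_pow, ← pow_mul, ← pow_mul, pow_add, pow_add]; ring
    _ ≤ q ^ (8 * S * (t * A)) * ((S:ℝ)^(2 * t * (t * A)) * B ^ (t * A)) := by
        have : S * A ≤ t * (S * A) := Nat.le_mul_of_pos_left _ ht
        gcongr
        · calc _ = 3 * (S * A) + 4 * (t * (S * A)) := by ring
            _ ≤ 8 * (t * (S * A)) := by omega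
            _ = _ := by ring
        · omega
    _ = _ := by
        rw [mul_pow, mul_pow, ← pow_mul, ← pow_mul]; ring

lemma res_exists {t D S : ℕ} (hD : 1 ≤ D) (hS : 1 ≤ S) :
    ∃ (R : MvPolynomial (U t (dd t D S)) ℤ) (e : Fin (t+1) → ℕ), IsRes R ∧
      (∀ i, IsWeightedHomogeneous (wt (dd t D S) i) R (e i)) ∧ e 0 ≤ S ^ t ∧
      ∀ i : Fin t, e i.succ ≤ D * S ^ (t-1) := by
  have hd : ∀ i, 1 ≤ dd t D S i := fun i => by
    refine Fin.cases hD (fun _ => hS) i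
  obtain ⟨R, h1, h2⟩ := exists_res (t := t) hd
  have hR : IsRes R := ⟨h1, h2⟩
  choose e he1 he2 using res_hom hR hd
  refine ⟨R, e, hR, he2, (he1 0).trans (le_of_eq ?_), fun i => (he1 _).trans (le_of_eq ?_)⟩
  · have h := Finset.mul_prod_erase Finset.univ (dd t D S) (Finset.mem_univ 0)
    rw [Fin.prod_univ_succ] at h
    have h3 := Nat.eq_of_mul_eq_mul_left (hd 0) h
    rw [h3]
    simp [dd]
  · have h := Finset.mul_prod_erase Finset.univ (dd t D S) (Finset.mem_univ i.succ)
    rw [Fin.prod_univ_succ] at h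
    refine Nat.eq_of_mul_eq_mul_left (hd i.succ) (h.trans ?_)
    obtain ⟨k, rfl⟩ : ∃ k, t = k + 1 := ⟨t - 1, by have := i.2; omega⟩
    simp [dd]
    ring

end BM

namespace BM
open MvPolynomial NumberField nonZeroDivisors

lemma ev_map_coeff {t n : ℕ} {A B : Type*} [CommRing A] [CommRing B] (φ : A →+* B)
    (Q : MvPolynomial (Fin (t+1)) A) (hQ : Q.IsHomogeneous n) (z : Fin (t+1) → B) :
    ev (fun m : Mon t n => φ (coeff m.1 Q)) z = eval₂ φ z Q := by
  have := sum_coeff_mpow (map φ Q) (hQ.map φ) z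
  simp only [coeff_map] at this
  rw [eval_map] at this
  exact this

lemma norm_eq_iSup {t n : ℕ} {A : Type*} [CommRing A] (φ : A →+* ℂ)
    (Q : MvPolynomial (Fin (t+1)) A) (hQ : Q.IsHomogeneous n) (hQ0 : Q ≠ 0) :
    ‖(fun m : Mon t n => φ (coeff m.1 Q))‖ = ⨆ m : ↥Q.support, ‖φ (coeff m Q)‖ := by
  have hne : Nonempty Q.support := by
    obtain ⟨m, hm⟩ := ne_zero_iff.1 hQ0
    exact ⟨⟨m, mem_support_iff.2 hm⟩⟩
  have hbdd : BddAbove (Set.range fun m : ↥Q.support => ‖φ (coeff m Q)‖) := Set.finite_range _ |>.bddAbove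
  apply le_antisymm
  · rw [pi_norm_le_iff_of_nonneg (Real.iSup_nonneg fun _ => norm_nonneg _)]
    intro m
    by_cases hm : m.1 ∈ Q.support
    · exact le_ciSup hbdd ⟨m.1, hm⟩
    · rw [notMem_support_iff.1 hm]
      simpa using Real.iSup_nonneg fun _ => norm_nonneg _
  · refine ciSup_le fun m => ?_
    have hm : m.1.degree = n := by
      by_contra h
      exact mem_support_iff.1 m.2 (hQ.coeff_eq_zero h)
    exact norm_le_pi_norm (fun m : Mon t n => φ (coeff m.1 Q)) ⟨m.1, hm⟩

lemma polyH_pow (K : IntermediateField ℚ ℂ) [NumberField K] {t : ℕ}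
    (Q : MvPolynomial (Fin (t + 1)) K) :
    polyH K Q ^ (Module.finrank ℚ K) = (∏ σ : K →+* ℂ, ⨆ m : ↥Q.support, ‖σ (coeff m Q)‖) *
      ((FractionalIdeal.absNorm (FractionalIdeal.spanFinset (𝓞 K)
      (Finset.univ : Finset Q.support) (fun m => coeff m Q)) : ℚ) : ℝ)⁻¹ := by
  have h0 : Module.finrank ℚ K ≠ 0 := Module.finrank_pos.ne'
  have h1 : 0 ≤ (∏ σ : K →+* ℂ, ⨆ m : ↥Q.support, ‖σ (coeff m Q)‖) :=
    Finset.prod_nonneg fun σ _ => Real.iSup_nonneg fun _ => norm_nonneg _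
  have h2 : (0:ℝ) ≤ ((FractionalIdeal.absNorm (FractionalIdeal.spanFinset (𝓞 K)
      (Finset.univ : Finset Q.support) (fun m => coeff m Q)) : ℚ) : ℝ) := by
    exact_mod_cast FractionalIdeal.absNorm_nonneg _
  unfold polyH HV HinfV HfinV
  rw [mul_pow, Real.rpow_inv_natCast_pow h1 h0, Real.rpow_neg h2, inv_pow,
    Real.rpow_inv_natCast_pow h2 h0]

end BM


set_option maxHeartbeats 4000000

theorem brownawell_masser_resultant_bound
    (K : IntermediateField ℚ ℂ) [NumberField K]
    (d : ℕ) (hd : d = Module.finrank ℚ K)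
    (t : ℕ) (ht : 1 ≤ t) (D S : ℕ) (hD : 1 ≤ D) (hDS : D ≤ S)
    (F : Finset (MvPolynomial (Fin (t + 1)) K))
    (hFint : ∀ Q ∈ F, ∀ m, IsIntegral ℤ (Q.coeff m))
    (hFhom : ∀ Q ∈ F, MvPolynomial.IsHomogeneous Q S)
    (hFnz : ¬∃ z : Fin (t + 1) → ℂ, z ≠ 0 ∧ ∀ Q ∈ F, MvPolynomial.aeval z Q = 0)
    (P : MvPolynomial (Fin (t + 1)) K) (hP : P ≠ 0)
    (hPhom : P.IsHomogeneous D)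
    (ξ : Fin t → ℂ)
    (B δ : ℝ) (hB : 0 < B) (hδ : 0 < δ)
    (hQB : ∀ Q ∈ F, ∀ σ : K →+* ℂ, ∀ m, ‖σ (Q.coeff m)‖ ≤ B)
    (hQδ : ∀ Q ∈ F, ‖(MvPolynomial.aeval (Fin.cons 1 ξ) Q : ℂ)‖ ≤ δ) :
    1 ≤ polyH K P ^ (d * S ^ t)
        * (((t : ℝ) + 1) ^ (8 * S) * (S : ℝ) ^ (2 * t) * B) ^ (d * t * D * S ^ (t - 1))
        * max (δ / B)
            (‖(MvPolynomial.aeval (Fin.cons 1 ξ) P : ℂ)‖ / polyNorm K P) := by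
  classical
  have hS : 1 ≤ S := hD.trans hDS
  obtain ⟨R, e, hR, he, he0, he1⟩ := BM.res_exists (t := t) hD hS
  have hdd : ∀ i, 1 ≤ BM.dd t D S i := fun i => Fin.cases hD (fun _ => hS) i
  let σ₀ : K →+* ℂ := algebraMap K ℂ
  have haev : ∀ (z : Fin (t+1) → ℂ) (Q : MvPolynomial (Fin (t+1)) K),
      MvPolynomial.aeval z Q = MvPolynomial.eval₂ σ₀ z Q := fun z Q => rfl
  let pK : BM.Mon t D → K := fun m => P.coeff m.1
  let fK : ↥F → BM.Mon t S → K := fun Q m => Q.1.coeff m.1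
  let T : (K →+* ℂ) → ℝ := fun σ => ⨆ m : ↥P.support, ‖σ (P.coeff m)‖
  have hT : ∀ σ, ‖(fun m => σ (pK m))‖ = T σ := fun σ => BM.norm_eq_iSup σ P hPhom hP
  have hpne : ∃ m : BM.Mon t D, pK m ≠ 0 := by
    obtain ⟨m, hm⟩ := MvPolynomial.ne_zero_iff.1 hP
    have hmd : m.degree = D := by
      by_contra h
      exact hm (hPhom.coeff_eq_zero h)
    exact ⟨⟨m, hmd⟩, hm⟩
  obtain ⟨m₀, hm₀⟩ := hpne
  have hTm : ∀ σ, ‖σ (pK m₀)‖ ≤ T σ := fun σ => by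
    rw [← hT]; exact norm_le_pi_norm (fun m => σ (pK m)) m₀
  have hTpos : ∀ σ, 0 < T σ := fun σ =>
    lt_of_lt_of_le (norm_pos_iff.2 ((map_ne_zero σ).2 hm₀)) (hTm σ)
  have hfz : ∀ z, (∀ Q : ↥F, BM.ev (fun m => σ₀ (fK Q m)) z = 0) → z = 0 := by
    intro z hz
    by_contra h
    refine hFnz ⟨z, h, fun Q hQ => ?_⟩
    have := hz ⟨Q, hQ⟩
    rw [haev, ← BM.ev_map_coeff σ₀ Q (hFhom Q hQ) z]
    exact this
  -- B is at least one
  have hB1 : 1 ≤ B := by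
    have : ∃ Q : ↥F, ∃ m, fK Q m ≠ 0 := by
      by_contra! h
      have := hfz 1 (fun Q => by simp [h, BM.ev])
      simpa using congrFun this 0
    obtain ⟨Q, m, hm⟩ := this
    have h1 := BM.one_le_prod_emb (fK Q m) hm (hFint Q.1 Q.2 _)
    have h2 : ∏ σ : K →+* ℂ, ‖σ (fK Q m)‖ ≤ ∏ σ : K →+* ℂ, B :=
      Finset.prod_le_prod (fun _ _ => norm_nonneg _) fun σ _ => hQB Q.1 Q.2 σ _
    by_contra! h3
    rw [Finset.prod_const] at h2
    have h4 : (Finset.univ : Finset (K →+* ℂ)).card ≠ 0 :=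
      Finset.card_ne_zero.2 ⟨σ₀, Finset.mem_univ _⟩
    have := pow_lt_one₀ hB.le h3 h4
    linarith
  obtain ⟨κ, _, g, a, hκ, ha, hr⟩ := BM.choice_N hR hD hS e he (D * S ^ (t-1)) he1
    (fun m => σ₀ (pK m)) (fun h => hm₀ (by
      have := congrFun h m₀
      exact (map_eq_zero σ₀).1 this)) (fun Q m => σ₀ (fK Q m)) hfz
  set A := D * S ^ (t-1) with hA
  set M := Fintype.card (BM.Mon t S) with hM
  let qK : Fin t → BM.Mon t S → K := fun i m => ∑ k, (a i k : K) * fK (g k) m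
  let r : K := BM.rv R (BM.mk pK qK)
  let cσ : (K →+* ℂ) → ∀ i, BM.Mon t (BM.dd t D S i) → ℂ := fun σ =>
    BM.mk (fun m => σ (pK m)) (fun i m => ∑ k, (a i k : ℂ) * σ (fK (g k) m))
  have hrσ : ∀ σ : K →+* ℂ, σ r = BM.rv R (cσ σ) := by
    intro σ
    simp only [r, cσ, qK]
    rw [BM.rv_map, BM.mk_map (fun y => σ y)]
    simp
  have hr0 : r ≠ 0 := by
    intro h
    apply hr
    have := hrσ σ₀
    rw [h, map_zero] at this
    exact this.symm
  -- coefficient bounds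
  have hsum : ∀ (i : Fin t) (y : κ → ℂ) (β : ℝ), 0 ≤ β → (∀ k, ‖y k‖ ≤ β) →
      ‖∑ k, (a i k : ℂ) * y k‖ ≤ M * A * β := by
    intro i y β hβ hy
    calc ‖∑ k, (a i k : ℂ) * y k‖ ≤ ∑ k, ‖(a i k : ℂ) * y k‖ := norm_sum_le _ _
      _ ≤ ∑ k : κ, (A : ℝ) * β := by
        refine Finset.sum_le_sum fun k _ => ?_
        rw [norm_mul, Complex.norm_natCast]
        have h1 : (a i k : ℝ) ≤ A := by exact_mod_cast ha i k
        have h2 := hy k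
        gcongr
      _ = (Fintype.card κ : ℝ) * (A * β) := by simp
      _ ≤ M * (A * β) := by
        have : (Fintype.card κ : ℝ) ≤ M := by exact_mod_cast hκ
        gcongr
      _ = _ := by ring
  let b : (K →+* ℂ) → Fin (t+1) → ℝ := fun σ => Fin.cons (T σ) (fun _ => M * A * B)
  have hb : ∀ σ i, ‖cσ σ i‖ ≤ b σ i := by
    intro σ i
    refine Fin.cases ?_ (fun i => ?_) i
    · exact (hT σ).le
    · change ‖(fun m : BM.Mon t S => ∑ k, (a i k : ℂ) * σ (fK (g k) m))‖ ≤ M * A * B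
      rw [pi_norm_le_iff_of_nonneg (by positivity)]
      intro m
      exact hsum i _ B hB.le fun k => hQB _ (g k).2 σ _
  set ε := max (δ / B) (‖(MvPolynomial.aeval (Fin.cons 1 ξ) P : ℂ)‖ / polyNorm K P) with hε
  have hε0 : 0 < ε := lt_max_of_lt_left (by positivity)
  have hpN : polyNorm K P = T σ₀ := rfl
  let W : ℝ := ((Fintype.card (BM.Mon t D) : ℝ) * 2) ^ e 0 *
    (∏ i : Fin t, ((M : ℝ) * (2 * (M * A * B))) ^ e i.succ) *
      ((t:ℝ)+1) ^ (∑ i, BM.dd t D S i * e i)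
  have hW0 : 0 ≤ W :=
    mul_nonneg (mul_nonneg (by positivity) (Finset.prod_nonneg fun i _ => by positivity))
      (by positivity)
  have hWb : ∀ σ, (∏ i, (Fintype.card (BM.Mon t (BM.dd t D S i)) * (2 * b σ i)) ^ e i) *
      ((t:ℝ)+1) ^ (∑ i, BM.dd t D S i * e i) = T σ ^ e 0 * W := by
    intro σ
    rw [Fin.prod_univ_succ]
    change ((Fintype.card (BM.Mon t D) : ℝ) * (2 * T σ)) ^ e 0 *
      (∏ i : Fin t, ((M : ℝ) * (2 * (M * A * B))) ^ e i.succ) * _ = _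
    simp only [W]
    rw [← mul_assoc (Fintype.card (BM.Mon t D) : ℝ), mul_pow _ (T σ)]
    ring
  have hall : ∀ σ, ‖σ r‖ ≤ T σ ^ e 0 * W := by
    intro σ
    rw [hrσ, ← hWb]
    refine (BM.rv_bound hR hdd e he (cσ σ)).trans ?_
    gcongr with i
    have h1 := hb σ i
    have h2 := norm_nonneg (cσ σ i)
    linarith
  have hone : ‖σ₀ r‖ ≤ ε * (T σ₀ ^ e 0 * W) := by
    rw [hrσ, ← hWb]
    refine BM.schwarz_rv hR hdd e he (cσ σ₀) (Fin.cons 1 ξ) rfl ε hε0 (b σ₀) (hb σ₀) ?_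
    intro i
    refine Fin.cases ?_ (fun i => ?_) i
    · change ‖BM.ev (fun m : BM.Mon t D => σ₀ (P.coeff m.1)) (Fin.cons 1 ξ)‖ ≤ ε * T σ₀
      rw [BM.ev_map_coeff σ₀ P hPhom, ← haev, ← div_le_iff₀ (hTpos _), ← hpN]
      exact le_max_right _ _
    · change ‖BM.ev (fun m : BM.Mon t S => ∑ k, (a i k : ℂ) * σ₀ (fK (g k) m)) (Fin.cons 1 ξ)‖ ≤
        ε * (M * A * B)
      have h1 : BM.ev (fun m : BM.Mon t S => ∑ k, (a i k : ℂ) * σ₀ (fK (g k) m)) (Fin.cons 1 ξ) =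
          ∑ k, (a i k : ℂ) * BM.ev (fun m : BM.Mon t S => σ₀ (fK (g k) m)) (Fin.cons 1 ξ) := by
        simp only [BM.ev, Finset.sum_mul, Finset.mul_sum, mul_assoc]
        rw [Finset.sum_comm]
      rw [h1]
      have h2 := hsum i (fun k => BM.ev (fun m : BM.Mon t S => σ₀ (fK (g k) m)) (Fin.cons 1 ξ)) δ
        hδ.le (fun k => by
          have := BM.ev_map_coeff σ₀ (g k).1 (hFhom _ (g k).2) (Fin.cons 1 ξ)
          change ‖BM.ev (fun m : BM.Mon t S => σ₀ ((g k).1.coeff m.1)) (Fin.cons 1 ξ)‖ ≤ δ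
          rw [this]
          exact hQδ _ (g k).2)
      refine h2.trans ?_
      have h3 : δ ≤ ε * B := by
        rw [← div_le_iff₀ hB]; exact le_max_left _ _
      calc (M:ℝ) * A * δ ≤ M * A * (ε * B) := by gcongr
        _ = _ := by ring
  -- product over embeddings
  have hcard : (Finset.univ : Finset (K →+* ℂ)).card = d := by
    rw [Finset.card_univ, hd]
    exact NumberField.Embeddings.card K ℂ
  have hprod : ∏ σ : K →+* ℂ, ‖σ r‖ ≤ ε * ((∏ σ, T σ) ^ e 0 * W ^ d) := by
    calc ∏ σ : K →+* ℂ, ‖σ r‖ = ‖σ₀ r‖ * ∏ σ ∈ Finset.univ.erase σ₀, ‖σ r‖ :=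
          (Finset.mul_prod_erase _ _ (Finset.mem_univ σ₀)).symm
      _ ≤ (ε * (T σ₀ ^ e 0 * W)) * ∏ σ ∈ Finset.univ.erase σ₀, (T σ ^ e 0 * W) := by
          have h0 : 0 ≤ T σ₀ ^ e 0 * W := mul_nonneg (pow_nonneg (hTpos σ₀).le _) hW0
          refine mul_le_mul hone ?_ (Finset.prod_nonneg fun _ _ => norm_nonneg _)
            (mul_nonneg hε0.le h0)
          exact Finset.prod_le_prod (fun _ _ => norm_nonneg _) fun σ _ => hall σ
      _ = ε * ∏ σ, (T σ ^ e 0 * W) := by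
          rw [mul_assoc, Finset.mul_prod_erase _ (fun σ => T σ ^ e 0 * W) (Finset.mem_univ σ₀)]
      _ = _ := by
          rw [Finset.prod_mul_distrib, Finset.prod_pow, Finset.prod_const, hcard]
  set I := FractionalIdeal.spanFinset (NumberField.RingOfIntegers K)
      (Finset.univ : Finset P.support) (fun m => P.coeff m) with hI
  have hpI : ∀ m, pK m ∈ I := by
    intro m
    by_cases hm : m.1 ∈ P.support
    · rw [← FractionalIdeal.mem_coe, hI, FractionalIdeal.spanFinset_coe]
      exact Submodule.subset_span ⟨⟨m.1, hm⟩, by simp, rfl⟩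
    · have : pK m = 0 := MvPolynomial.notMem_support_iff.1 hm
      rw [this]
      exact FractionalIdeal.zero_mem I
  have hqI : ∀ i m, qK i m ∈ (1 : FractionalIdeal (nonZeroDivisors (NumberField.RingOfIntegers K)) K) := by
    intro i m
    have : IsIntegral ℤ (qK i m) := by
      refine IsIntegral.sum _ fun k _ => ?_
      refine IsIntegral.mul ?_ (hFint _ (g k).2 _)
      exact_mod_cast isIntegral_algebraMap (R := ℤ) (A := K) (x := (a i k : ℤ))
    rw [FractionalIdeal.mem_one_iff]
    exact ⟨⟨_, this⟩, rfl⟩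
  have hrI : r ∈ I ^ e 0 := by
    refine BM.aeval_mem_frac _ R _ (he 0) I _ ?_
    rintro ⟨i, m⟩
    revert m
    refine Fin.cases ?_ (fun i => ?_) i
    · intro m
      simp only [BM.wt, if_true, pow_one]
      exact hpI m
    · intro m
      have : BM.wt (BM.dd t D S) 0 ⟨i.succ, m⟩ = 0 := by simp [BM.wt]
      rw [this, pow_zero]
      exact hqI i m
  have hI0 : I ≠ 0 := by
    intro h
    have := hpI m₀
    rw [h, FractionalIdeal.mem_zero_iff] at this
    exact hm₀ this
  set N : ℝ := ((FractionalIdeal.absNorm I : ℚ) : ℝ) with hN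
  have hN0 : 0 < N := by
    have h1 := FractionalIdeal.absNorm_nonneg I
    have h2 : FractionalIdeal.absNorm I ≠ 0 := by
      rwa [Ne, FractionalIdeal.absNorm_eq_zero_iff]
    have h3 : 0 < FractionalIdeal.absNorm I := lt_of_le_of_ne h1 (Ne.symm h2)
    rw [hN]
    exact_mod_cast h3
  have hNr : N ^ e 0 ≤ ∏ σ : K →+* ℂ, ‖σ r‖ := by
    have := BM.absNorm_le (I ^ e 0) r hr0 hrI
    rw [map_pow, Rat.cast_pow] at this
    exact this
  have hNT : N ≤ ∏ σ, T σ :=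
    (BM.absNorm_le I (pK m₀) hm₀ (hpI m₀)).trans
      (Finset.prod_le_prod (fun _ _ => norm_nonneg _) fun σ _ => hTm σ)
  have hH : polyH K P ^ d = (∏ σ, T σ) * N⁻¹ := by
    rw [hd]; exact BM.polyH_pow K P
  have hH1 : 1 ≤ polyH K P ^ d := by
    rw [hH, ← div_eq_mul_inv, one_le_div hN0]; exact hNT
  have hWfin := BM.num_bound ht hD hDS (Fintype.card (BM.Mon t D)) M A (BM.card_Mon t D)
    (BM.card_Mon t S) hA B hB1 e he0 he1
  have h1 : 1 ≤ (polyH K P ^ d) ^ e 0 * W ^ d * ε := by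
    rw [hH, mul_pow, inv_pow]
    have h2 := hNr.trans hprod
    have h3 : 0 < N ^ e 0 := pow_pos hN0 _
    calc (1:ℝ) = N ^ e 0 * (N ^ e 0)⁻¹ := (mul_inv_cancel₀ h3.ne').symm
      _ ≤ (ε * ((∏ σ, T σ) ^ e 0 * W ^ d)) * (N ^ e 0)⁻¹ := by gcongr
      _ = _ := by ring
  refine h1.trans ?_
  rw [pow_mul]
  refine mul_le_mul_of_nonneg_right ?_ hε0.le
  refine mul_le_mul (pow_le_pow_right₀ hH1 he0) ?_ (pow_nonneg hW0 _)
    (pow_nonneg (zero_le_one.trans hH1) _)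
  have h5 : d * t * D * S ^ (t - 1) = t * A * d := by rw [hA]; ring
  rw [h5, pow_mul _ (t * A) d]
  exact pow_le_pow_left₀ hW0 hWfin d
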